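/- arXiv:1404.0122 — 2 statements merged into one kernel-verified Lean document; each statement's English description precedes it below -/
import Mathlib

section
/- Let 0 < α₁ < α₂ and let X_i ~ Gamma(α_i, α_i) for i = 1, 2, with Δ(x) = P(X₂ < x) − P(X₁ < x). The unique sign-change point x₀ of Δ satisfies 1 ≤ x₀ ≤ (2√(α₁(α₂−α₁)) + 1)/(2√(α₁(α₂−α₁))). -/
open MeasureTheory ProbabilityTheory Real Set

lemma gc_log_le_half (t : ℝ) (ht : 1 ≤ t) : 2 * Real.log t ≤ t - 1 / t := by
  have hmono : MonotoneOn (fun t : ℝ => t - 1 / t - 2 * Real.log t) (Ici 1) := by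
    apply monotoneOn_of_deriv_nonneg (convex_Ici 1)
    · apply ContinuousOn.sub
      · exact continuousOn_id.sub (continuousOn_const.div continuousOn_id
          (fun x hx => by have : (1:ℝ) ≤ x := hx; simp; linarith))
      · exact continuousOn_const.mul (continuousOn_id.log
          (fun x hx => by have : (1:ℝ) ≤ x := hx; simp; linarith))
    · intro x hx
      rw [interior_Ici] at hx
      have hx' : (1:ℝ) < x := hx
      have hx0 : x ≠ 0 := by linarith
      exact (((differentiableAt_id.sub ((differentiableAt_const _).div differentiableAt_id hx0)).sub
        ((differentiableAt_const _).mul (Real.differentiableAt_log hx0)))).differentiableWithinAt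
    · intro x hx
      rw [interior_Ici] at hx
      have hx' : (1:ℝ) < x := hx
      have hx0 : x ≠ 0 := by linarith
      have hd : HasDerivAt (fun t : ℝ => t - 1 / t - 2 * Real.log t)
          (1 - (0 * x - 1 * 1) / x ^ 2 - 2 * x⁻¹) x :=
        ((hasDerivAt_id x).sub ((hasDerivAt_const x (1:ℝ)).div (hasDerivAt_id x) hx0)).sub
          ((Real.hasDerivAt_log hx0).const_mul 2)
      rw [hd.deriv]
      have : 1 - (0 * x - 1 * 1) / x ^ 2 - 2 * x⁻¹ = (1 - x⁻¹) ^ 2 := by field_simp; ring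
      rw [this]; positivity
  have := hmono (mem_Ici.2 le_rfl) (mem_Ici.2 ht) ht
  simp at this
  simpa using this

lemma gc_two_le_log (t : ℝ) (ht : 1 ≤ t) : 2 * (t - 1) / (t + 1) ≤ Real.log t := by
  have := Real.le_log_one_add_of_nonneg (x := t - 1) (by linarith)
  have e : t - 1 + 2 = t + 1 := by ring
  rw [e] at this
  simpa using this

/-- Padé upper bound. -/
lemma gc_log_pade (q : ℝ) (hq : 1 ≤ q) : Real.log q ≤ (q - 1) * (q + 5) / (4 * q + 2) := by
  have hmono : MonotoneOn (fun q : ℝ => (q - 1) * (q + 5) / (4 * q + 2) - Real.log q) (Ici 1) := by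
    have hder : ∀ x : ℝ, 1 ≤ x → HasDerivAt
        (fun q : ℝ => (q - 1) * (q + 5) / (4 * q + 2) - Real.log q)
        (((1 * (x + 5) + (x - 1) * 1) * (4 * x + 2) - (x - 1) * (x + 5) * (4 * 1)) / (4 * x + 2) ^ 2
          - x⁻¹) x := by
      intro x hx
      have hx0 : x ≠ 0 := by linarith
      have hx1 : 4 * x + 2 ≠ 0 := by linarith
      exact ((((hasDerivAt_id x).sub_const 1).mul ((hasDerivAt_id x).add_const 5)).div
        (((hasDerivAt_id x).const_mul 4).add_const 2) hx1).sub (Real.hasDerivAt_log hx0)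
    apply monotoneOn_of_deriv_nonneg (convex_Ici 1)
    · exact fun x hx => (hder x hx).continuousAt.continuousWithinAt
    · intro x hx
      rw [interior_Ici] at hx
      exact (hder x (le_of_lt hx)).differentiableAt.differentiableWithinAt
    · intro x hx
      rw [interior_Ici] at hx
      have hx' : (1:ℝ) < x := hx
      rw [(hder x hx'.le).deriv]
      have hx0 : 0 < x := by linarith
      have : ((1 * (x + 5) + (x - 1) * 1) * (4 * x + 2) - (x - 1) * (x + 5) * (4 * 1))
          / (4 * x + 2) ^ 2 - x⁻¹ = 4 * (x - 1) ^ 3 / (x * (4 * x + 2) ^ 2) := by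
        field_simp; ring
      rw [this]
      have : 0 ≤ (x - 1) ^ 3 := by apply pow_nonneg; linarith
      positivity
  have := hmono (mem_Ici.2 le_rfl) (mem_Ici.2 hq) hq
  simp at this
  linarith

lemma gc_log_five : Real.log 5 ≤ 1.61 := by
  have h2 := Real.log_two_lt_d9
  have h5 : Real.log 5 = 2 * Real.log 2 + Real.log (5/4) := by
    have : (5:ℝ) = 2 ^ 2 * (5/4) := by norm_num
    rw [this, Real.log_mul (by norm_num) (by norm_num), Real.log_pow]; norm_num
  have := gc_log_pade (5/4) (by norm_num)
  rw [h5]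
  norm_num at this ⊢
  linarith

lemma gc_log_one_add_sq (W : ℝ) (hW : 0 ≤ W) : Real.log (1 + W ^ 2) ≤ 0.83 * W := by
  by_cases h : W ≤ 1/2
  · have := Real.log_le_sub_one_of_pos (show 0 < 1 + W^2 by positivity)
    nlinarith
  push Not at h
  have hder : ∀ x : ℝ, HasDerivAt (fun W : ℝ => 0.8 * W - Real.log (1 + W ^ 2))
      (0.8 * 1 - (2 * x) / (1 + x ^ 2)) x := by
    intro x
    have h1 : HasDerivAt (fun W : ℝ => 1 + W ^ 2) (2 * x) x := by
      simpa using (hasDerivAt_pow 2 x).const_add 1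
    exact ((hasDerivAt_id x).const_mul 0.8).sub (h1.log (by positivity))
  have hval : ∀ x : ℝ, (0.8:ℝ) * 1 - (2 * x) / (1 + x ^ 2) = 0.8 * (x - 2) * (x - 1/2) / (1 + x ^ 2) := by
    intro x
    have : (1 + x^2) ≠ 0 := by positivity
    field_simp; ring
  have hc : Continuous (fun W : ℝ => 0.8 * W - Real.log (1 + W ^ 2)) :=
    continuous_iff_continuousAt.2 fun x => (hder x).continuousAt
  have key : 0.8 * 2 - Real.log (1 + 2 ^ 2) ≤ 0.8 * W - Real.log (1 + W ^ 2) := by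
    rcases le_total 2 W with h2 | h2
    · have : MonotoneOn (fun W : ℝ => 0.8 * W - Real.log (1 + W ^ 2)) (Ici 2) := by
        apply monotoneOn_of_deriv_nonneg (convex_Ici 2) hc.continuousOn
        · exact fun x _ => (hder x).differentiableAt.differentiableWithinAt
        · intro x hx
          rw [interior_Ici] at hx
          have hx' : (2:ℝ) < x := hx
          rw [(hder x).deriv, hval]
          apply div_nonneg _ (by positivity)
          apply mul_nonneg (mul_nonneg (by norm_num) _) <;> linarith
      exact this (mem_Ici.2 le_rfl) (mem_Ici.2 h2) h2
    · have : AntitoneOn (fun W : ℝ => 0.8 * W - Real.log (1 + W ^ 2)) (Icc (1/2) 2) := by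
        apply antitoneOn_of_deriv_nonpos (convex_Icc _ _) hc.continuousOn
        · exact fun x _ => (hder x).differentiableAt.differentiableWithinAt
        · intro x hx
          rw [interior_Icc] at hx
          rw [(hder x).deriv, hval]
          apply div_nonpos_of_nonpos_of_nonneg _ (by positivity)
          have := hx.1; have := hx.2
          apply mul_nonpos_of_nonpos_of_nonneg _ (by linarith)
          apply mul_nonpos_of_nonneg_of_nonpos (by norm_num) (by linarith)
      exact this ⟨h.le, h2⟩ ⟨by norm_num, le_rfl⟩ h2
  have h5 := gc_log_five
  norm_num at key h5 ⊢
  linarith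

set_option maxHeartbeats 1000000 in
/-- The final elementary inequality. -/
lemma gc_elem (a d y : ℝ) (ha : 0 < a) (hd : 0 < d) (hy : 0 < y) (hady : 4 * a * d * y ^ 2 = 1) :
    Real.log (1 + d / (a * (1 + 5 * (a + d)))) ≤ 2 * d * (y - Real.log (1 + y)) := by
  set h := y - Real.log (1 + y) with hh
  set w := 2 * d * y with hw
  set N := 1 + 5 * (a + d) with hN
  have hNpos : 0 < N := by positivity
  have hwpos : 0 < w := by positivity
  have haw : a * w ^ 2 = d := by rw [hw]; linear_combination d * hady
  have hX : d / (a * N) = w ^ 2 / N := by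
    rw [div_eq_div_iff (by positivity) (by positivity)]
    rw [← haw]; ring
  rw [hX]
  set q := Real.sqrt (1 + y) with hq
  have hq2 : q ^ 2 = 1 + y := Real.sq_sqrt (by positivity)
  have hq1 : 1 < q := by rw [hq]; exact Real.lt_sqrt_of_sq_lt (by linarith)
  have hlog : Real.log (1 + y) ≤ (q - 1) * (q + 5) / (2 * q + 1) := by
    rw [← hq2, Real.log_pow]
    have := gc_log_pade q hq1.le
    have e : (q - 1) * (q + 5) / (2 * q + 1) = 2 * ((q - 1) * (q + 5) / (4 * q + 2)) := by
      field_simp; ring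
    rw [e]; push_cast; linarith
  have hyq : y = q ^ 2 - 1 := by linarith
  have hhq : 2 * (q - 1) ^ 2 * (q + 2) / (2 * q + 1) ≤ h := by
    rw [hh]
    have e : 2 * (q - 1) ^ 2 * (q + 2) / (2 * q + 1) = y - (q - 1) * (q + 5) / (2 * q + 1) := by
      rw [hyq]; field_simp; ring
    rw [e]; linarith
  have hhpos : 0 < h := by
    refine lt_of_lt_of_le ?_ hhq
    have : 0 < q - 1 := by linarith
    positivity
  by_cases hcase : q ^ 2 + q ≤ 5
  · -- small y
    have h1 : y ^ 2 ≤ (y + 5/2) * h := by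
      have : y ^ 2 ≤ (y + 5/2) * (2 * (q - 1) ^ 2 * (q + 2) / (2 * q + 1)) := by
        rw [hyq, mul_div_assoc', le_div_iff₀ (by linarith)]
        have : (q ^ 2 - 1 + 5/2) * (2 * (q - 1) ^ 2 * (q + 2)) - (q ^ 2 - 1) ^ 2 * (2 * q + 1)
          = (q - 1) ^ 2 * (5 - (q ^ 2 + q)) := by ring
        have h3 : 0 ≤ (q - 1) ^ 2 * (5 - (q ^ 2 + q)) :=
          mul_nonneg (pow_nonneg (by linarith) 2) (by linarith)
        linarith
      refine this.trans (mul_le_mul_of_nonneg_left hhq (by positivity))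
    set X := w ^ 2 / N with hXd
    have hXpos : 0 < X := by positivity
    have hr : Real.log (1 + X) ≤ X / Real.sqrt (1 + X) := by
      set r := Real.sqrt (1 + X) with hr
      have hr2 : r ^ 2 = 1 + X := Real.sq_sqrt (by positivity)
      have hr1 : 1 ≤ r := by rw [hr]; exact Real.le_sqrt_of_sq_le (by linarith)
      have := gc_log_le_half r hr1
      have e : X / r = r - 1 / r := by
        have : X = r ^ 2 - 1 := by linarith
        rw [this]; field_simp
      rw [← hr2, Real.log_pow, e]; push_cast; exact this
    refine hr.trans ?_
    rw [div_le_iff₀ (by positivity)]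
    have hsq : Real.sqrt (1 + X) ^ 2 = 1 + X := Real.sq_sqrt (by positivity)
    apply le_of_sq_le_sq _ (by positivity)
    rw [mul_pow, hsq]
    -- X^2 ≤ (2 d h)^2 (1+X)
    have hXN : X * N = w ^ 2 := by rw [hXd]; field_simp
    have h2 : w ≤ (w + 5 * d) * (h / y) := by
      rw [mul_div_assoc', le_div_iff₀ hy, hw]
      nlinarith [mul_le_mul_of_nonneg_left h1 hd.le]
    have h3 : (w + 5 * d) ^ 2 ≤ N * (N + w ^ 2) := by
      have e1 : N * w ^ 2 = w ^ 2 + 5 * d + 5 * d * w ^ 2 := by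
        rw [hN]; linear_combination 5 * haw
      have : (5 * d) ^ 2 ≤ N ^ 2 := by
        apply pow_le_pow_left₀ (by positivity); rw [hN]; linarith
      nlinarith [mul_nonneg hd.le (sq_nonneg (w - 1))]
    have h4 : 2 * d * h = w * (h / y) := by rw [hw]; field_simp
    rw [h4]
    have h5 : w ^ 2 ≤ (w + 5 * d) ^ 2 * (h / y) ^ 2 := by
      rw [← mul_pow]; exact pow_le_pow_left₀ hwpos.le h2 2
    have h6 : w ^ 2 ≤ N * (N + w ^ 2) * (h / y) ^ 2 :=
      h5.trans (mul_le_mul_of_nonneg_right h3 (by positivity))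
    have h7 : X ^ 2 * N ^ 2 ≤ (w * (h / y)) ^ 2 * (1 + X) * N ^ 2 := by
      calc X ^ 2 * N ^ 2 = w ^ 2 * w ^ 2 := by rw [← mul_pow, hXN]; ring
        _ ≤ w ^ 2 * (N * (N + w ^ 2) * (h / y) ^ 2) := mul_le_mul_of_nonneg_left h6 (by positivity)
        _ = (w * (h / y)) ^ 2 * (1 + X) * N ^ 2 := by
            have e9 : N + w ^ 2 = N * (1 + X) := by rw [← hXN]; ring
            rw [e9]; ring
    exact le_of_mul_le_mul_right h7 (by positivity)
  · push Not at hcase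
    have hq17 : 1.79 < q := by nlinarith
    have hNy : 1 + 5 / y ≤ N := by
      have : 1 / y ≤ a + d := by
        rw [div_le_iff₀ hy]
        have : (2 * ((a + d) * y)) ^ 2 ≥ 2 ^ 2 := by nlinarith [sq_nonneg ((a - d) * y)]
        have := abs_le_of_sq_le_sq' this (by positivity)
        linarith [this.2]
      have e : 5 / y = 5 * (1 / y) := by ring
      rw [hN, e]; linarith
    set W := w * Real.sqrt (y / (y + 5)) with hW
    have hW2 : W ^ 2 = w ^ 2 * (y / (y + 5)) := by
      rw [hW, mul_pow, Real.sq_sqrt (by positivity)]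
    have hle : w ^ 2 / N ≤ W ^ 2 := by
      rw [hW2, div_eq_mul_inv]
      apply mul_le_mul_of_nonneg_left _ (by positivity)
      have : y / (y + 5) = (1 + 5 / y)⁻¹ := by field_simp
      rw [this]
      exact inv_anti₀ (by positivity) hNy
    have h1 : Real.log (1 + w ^ 2 / N) ≤ Real.log (1 + W ^ 2) :=
      Real.log_le_log (by positivity) (by linarith)
    refine h1.trans ((gc_log_one_add_sq W (by positivity)).trans ?_)
    have h4 : 2 * d * h = w * (h / y) := by rw [hw]; field_simp
    rw [h4, hW]
    have : 0.83 * Real.sqrt (y / (y + 5)) ≤ h / y := by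
      apply le_of_sq_le_sq _ (by positivity)
      rw [mul_pow, Real.sq_sqrt (by positivity)]
      have hb : 2 * (q - 1) * (q + 2) / ((2 * q + 1) * (q + 1)) ≤ h / y := by
        rw [le_div_iff₀ hy]
        refine le_trans (le_of_eq ?_) hhq
        rw [hyq]; field_simp; ring
      have hb2 : (2 * (q - 1) * (q + 2) / ((2 * q + 1) * (q + 1))) ^ 2 ≤ (h / y) ^ 2 := by
        apply pow_le_pow_left₀ _ hb
        have : 0 < q - 1 := by linarith
        positivity
      refine le_trans ?_ hb2
      have hq0 : 0 < q - 1 := by linarith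
      rw [div_pow, hyq, mul_div_assoc', div_le_div_iff₀ (by nlinarith) (by positivity)]
      obtain ⟨u, hu⟩ : ∃ u, q = 1.79 + u := ⟨q - 1.79, by ring⟩
      have hu0 : 0 < u := by linarith
      have main : 0 ≤ 4 * (q - 1) * (q + 2) ^ 2 * (q ^ 2 + 4) - 0.83 ^ 2 * (2 * q + 1) ^ 2 * (q + 1) ^ 3 := by
        rw [hu]; ring_nf; positivity
      have hm := mul_nonneg hq0.le main
      have e : (2 * (q - 1) * (q + 2)) ^ 2 * (q ^ 2 - 1 + 5)
          - 0.83 ^ 2 * (q ^ 2 - 1) * ((2 * q + 1) * (q + 1)) ^ 2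
          = (q - 1) * (4 * (q - 1) * (q + 2) ^ 2 * (q ^ 2 + 4)
            - 0.83 ^ 2 * (2 * q + 1) ^ 2 * (q + 1) ^ 3) := by ring
      exact sub_nonneg.1 (e ▸ hm)
    calc 0.83 * (w * Real.sqrt (y / (y + 5))) = w * (0.83 * Real.sqrt (y / (y + 5))) := by ring
      _ ≤ w * (h / y) := mul_le_mul_of_nonneg_left this hwpos.le

/-- The Stirling-type remainder. -/
noncomputable def gcTheta (a : ℝ) : ℝ :=
  Real.log (Real.Gamma a) + a - a * Real.log a + 1 / 2 * Real.log a

lemma gcTheta_step (a : ℝ) (ha : 0 < a) :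
    gcTheta a - gcTheta (a + 1) = (a + 1 / 2) * (Real.log (a + 1) - Real.log a) - 1 := by
  unfold gcTheta
  rw [Real.Gamma_add_one ha.ne', Real.log_mul ha.ne' (Real.Gamma_pos_of_pos ha).ne']
  ring

lemma gc_logGamma_shift (a : ℝ) (ha : 0 < a) (n : ℕ) :
    Real.log (Real.Gamma (a + n)) = Real.log (Real.Gamma a)
      + ∑ m ∈ Finset.range n, Real.log (a + m) := by
  induction n with
  | zero => simp
  | succ n ih =>
    have hp : 0 < a + n := by positivity
    rw [Finset.sum_range_succ, ← add_assoc, ← ih]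
    push_cast
    rw [← add_assoc, Real.Gamma_add_one hp.ne', Real.log_mul hp.ne' (Real.Gamma_pos_of_pos hp).ne']
    ring

lemma gcTheta_tendsto (a : ℝ) (ha : 0 < a) :
    Filter.Tendsto (fun n : ℕ => gcTheta (a + ((n + 1 : ℕ) : ℝ))
      - (Real.log (n.factorial : ℝ) + n - (n + 1 / 2) * Real.log n)) Filter.atTop (nhds 0) := by
  have h1 := Real.BohrMollerup.tendsto_log_gamma ha
  have h2 : Filter.Tendsto (fun n : ℕ => (n : ℝ) * Real.log (1 + (a + 1) / n)) Filter.atTop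
      (nhds (a + 1)) :=
    (Real.tendsto_mul_log_one_add_div_atTop (a + 1)).comp tendsto_natCast_atTop_atTop
  have h3 : Filter.Tendsto (fun n : ℕ => Real.log (1 + (a + 1) / n)) Filter.atTop (nhds 0) := by
    have : Filter.Tendsto (fun n : ℕ => 1 + (a + 1) / (n : ℝ)) Filter.atTop (nhds (1 + 0)) :=
      (tendsto_const_div_atTop_nhds_zero_nat (a + 1)).const_add 1
    rw [add_zero] at this
    have h := (Real.continuousAt_log one_ne_zero).tendsto.comp this
    rw [Real.log_one] at h
    exact h
  have h4 := ((tendsto_const_nhds (x := Real.log (Real.Gamma a))).sub h1).add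
    (((tendsto_const_nhds (x := a + 1)).sub h2).sub (h3.const_mul (a + 1 / 2)))
  simp only [sub_self, mul_zero, add_zero] at h4
  refine h4.congr' ?_
  filter_upwards [Filter.eventually_gt_atTop 0] with n hn
  have hn' : (0 : ℝ) < n := by exact_mod_cast hn
  have hl : Real.log (a + ((n + 1 : ℕ) : ℝ)) = Real.log n + Real.log (1 + (a + 1) / n) := by
    rw [← Real.log_mul hn'.ne' (by positivity)]
    congr 1
    push_cast
    field_simp
    ring
  unfold gcTheta Real.BohrMollerup.logGammaSeq
  rw [gc_logGamma_shift a ha, hl]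
  push_cast
  ring

/-- Telescoping comparison. -/
lemma gc_telescope (G : ℝ → ℝ) (p q : ℝ)
    (hstep : ∀ m : ℕ, G (p + m) - G (p + m + 1) ≤ G (q + m) - G (q + m + 1))
    (hlim : Filter.Tendsto (fun n : ℕ => G (p + ((n + 1 : ℕ) : ℝ)) - G (q + ((n + 1 : ℕ) : ℝ)))
      Filter.atTop (nhds 0)) : G p ≤ G q := by
  have hm : Monotone (fun n : ℕ => G (p + (n : ℝ)) - G (q + (n : ℝ))) := by
    apply monotone_nat_of_le_succ
    intro n
    have := hstep n
    push_cast
    rw [← add_assoc, ← add_assoc]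
    linarith
  have hl : Filter.Tendsto (fun n : ℕ => G (p + (n : ℝ)) - G (q + (n : ℝ))) Filter.atTop (nhds 0) :=
    (Filter.tendsto_add_atTop_iff_nat 1).1 hlim
  have := hm.ge_of_tendsto hl 0
  simp at this
  linarith

lemma gcTheta_lim (p q : ℝ) (hp : 0 < p) (hq : 0 < q) :
    Filter.Tendsto (fun n : ℕ => gcTheta (p + ((n + 1 : ℕ) : ℝ)) - gcTheta (q + ((n + 1 : ℕ) : ℝ)))
      Filter.atTop (nhds 0) := by
  have := (gcTheta_tendsto p hp).sub (gcTheta_tendsto q hq)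
  rw [sub_zero] at this
  refine this.congr fun n => ?_
  ring

lemma gc_rho_anti : AntitoneOn (fun a : ℝ => (a + 1 / 2) * (Real.log (a + 1) - Real.log a) - 1)
    (Ioi 0) := by
  have hder : ∀ x : ℝ, 0 < x → HasDerivAt
      (fun a : ℝ => (a + 1 / 2) * (Real.log (a + 1) - Real.log a) - 1)
      (1 * (Real.log (x + 1) - Real.log x) + (x + 1 / 2) * (1 / (x + 1) - x⁻¹)) x := by
    intro x hx
    have hx1 : x + 1 ≠ 0 := by positivity
    exact (((hasDerivAt_id x).add_const (1 / 2)).mul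
      ((((hasDerivAt_id x).add_const 1).log hx1).sub (Real.hasDerivAt_log hx.ne'))).sub_const 1
  apply antitoneOn_of_deriv_nonpos (convex_Ioi 0)
  · exact fun x hx => (hder x hx).continuousAt.continuousWithinAt
  · intro x hx
    rw [interior_Ioi] at hx
    exact (hder x hx).differentiableAt.differentiableWithinAt
  · intro x hx
    rw [interior_Ioi] at hx
    have hx0 : 0 < x := hx
    rw [(hder x hx).deriv]
    have h := gc_log_le_half ((x + 1) / x) (by rw [le_div_iff₀ hx0]; linarith)
    rw [Real.log_div (by positivity) hx0.ne'] at h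
    have e : (x + 1) / x - 1 / ((x + 1) / x) = - (2 * ((x + 1 / 2) * (1 / (x + 1) - x⁻¹))) := by
      field_simp; ring
    rw [e] at h
    linarith

lemma gcTheta_anti (p q : ℝ) (hp : 0 < p) (hpq : p ≤ q) : gcTheta q ≤ gcTheta p := by
  have hq : 0 < q := by linarith
  apply gc_telescope gcTheta q p _ (gcTheta_lim q p hq hp)
  intro m
  have h1 : 0 < p + m := by positivity
  have h2 : 0 < q + m := by positivity
  rw [gcTheta_step _ h1, gcTheta_step _ h2]
  exact gc_rho_anti h1 h2 (by linarith)

lemma gc_F_nonneg (a : ℝ) (ha : 0 < a) :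
    0 ≤ Real.log (a + 1) - Real.log a - 1 / (a + 1) - (5 / 2) / (5 * a + 1) + (5 / 2) / (5 * a + 6) := by
  set F : ℝ → ℝ := fun a => Real.log (a + 1) - Real.log a - 1 / (a + 1) - (5 / 2) / (5 * a + 1)
    + (5 / 2) / (5 * a + 6) with hF
  have hder : ∀ x : ℝ, 0 < x → HasDerivAt F
      (1 / (x + 1) - x⁻¹ - (0 * (x + 1) - 1 * 1) / (x + 1) ^ 2
        - (0 * (5 * x + 1) - (5 / 2) * (5 * 1)) / (5 * x + 1) ^ 2
        + (0 * (5 * x + 6) - (5 / 2) * (5 * 1)) / (5 * x + 6) ^ 2) x := by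
    intro x hx
    have hx1 : x + 1 ≠ 0 := by positivity
    have hx2 : 5 * x + 1 ≠ 0 := by positivity
    have hx3 : 5 * x + 6 ≠ 0 := by positivity
    exact ((((((hasDerivAt_id x).add_const 1).log hx1).sub (Real.hasDerivAt_log hx.ne')).sub
      ((hasDerivAt_const x (1 : ℝ)).div ((hasDerivAt_id x).add_const 1) hx1)).sub
      ((hasDerivAt_const x (5 / 2 : ℝ)).div (((hasDerivAt_id x).const_mul 5).add_const 1) hx2)).add
      ((hasDerivAt_const x (5 / 2 : ℝ)).div (((hasDerivAt_id x).const_mul 5).add_const 6) hx3)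
  have hanti : AntitoneOn F (Ioi 0) := by
    apply antitoneOn_of_deriv_nonpos (convex_Ioi 0)
    · exact fun x hx => (hder x hx).continuousAt.continuousWithinAt
    · intro x hx
      rw [interior_Ioi] at hx
      exact (hder x hx).differentiableAt.differentiableWithinAt
    · intro x hx
      rw [interior_Ioi] at hx
      have hx0 : 0 < x := hx
      rw [(hder x hx).deriv]
      have e : (1 / (x + 1) - x⁻¹ - (0 * (x + 1) - 1 * 1) / (x + 1) ^ 2
        - (0 * (5 * x + 1) - (5 / 2) * (5 * 1)) / (5 * x + 1) ^ 2
        + (0 * (5 * x + 6) - (5 / 2) * (5 * 1)) / (5 * x + 6) ^ 2)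
        = ((25 / 2) * (50 * x + 35) * x * (x + 1) ^ 2 - (5 * x + 1) ^ 2 * (5 * x + 6) ^ 2)
          / (x * (x + 1) ^ 2 * ((5 * x + 1) ^ 2 * (5 * x + 6) ^ 2)) - 0 := by
        field_simp
        ring
      rw [e, sub_zero]
      apply div_nonpos_of_nonpos_of_nonneg _ (by positivity)
      have hc : 0 ≤ x * (x - 1 / 2) ^ 2 := by positivity
      nlinarith [sq_nonneg (x - 1 / 2), hx0, pow_pos hx0 3]
  have hlim : Filter.Tendsto F Filter.atTop (nhds 0) := by
    have t0 : Filter.Tendsto (fun x : ℝ => Real.log (x + 1) - Real.log x) Filter.atTop (nhds 0) :=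
      Real.tendsto_log_comp_add_sub_log 1
    have t1 : Filter.Tendsto (fun x : ℝ => 1 / (x + 1)) Filter.atTop (nhds 0) :=
      Filter.Tendsto.const_div_atTop (Filter.tendsto_atTop_add_const_right _ _ Filter.tendsto_id) _
    have t2 : ∀ c : ℝ, Filter.Tendsto (fun x : ℝ => (5 / 2) / (5 * x + c)) Filter.atTop (nhds 0) :=
      fun c => Filter.Tendsto.const_div_atTop (Filter.tendsto_atTop_add_const_right _ _
        (Filter.tendsto_id.const_mul_atTop (by norm_num))) _
    have := ((t0.sub t1).sub (t2 1)).add (t2 6)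
    simp only [sub_zero, add_zero] at this
    exact this
  have : ∀ᶠ x in Filter.atTop, F x ≤ F a := by
    filter_upwards [Filter.eventually_ge_atTop a] with x hx
    exact hanti ha (lt_of_lt_of_le ha hx) hx
  exact le_of_tendsto hlim this

noncomputable def gcG (a : ℝ) : ℝ := gcTheta a - 1 / 2 * Real.log (1 + 1 / (5 * a))

lemma gcG_step (a : ℝ) (ha : 0 < a) :
    gcG a - gcG (a + 1) = a * (Real.log (a + 1) - Real.log a) - 1
      - 1 / 2 * Real.log (5 * a + 1) + 1 / 2 * Real.log (5 * a + 6) := by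
  have h := gcTheta_step a ha
  have e : ∀ b : ℝ, 0 < b → Real.log (1 + 1 / (5 * b)) = Real.log (5 * b + 1) - (Real.log 5 + Real.log b) := by
    intro b hb
    rw [← Real.log_mul (by norm_num) hb.ne', ← Real.log_div (by positivity) (by positivity)]
    congr 1
    field_simp
  unfold gcG
  rw [e a ha, e (a + 1) (by positivity)]
  have : 5 * (a + 1) + 1 = 5 * a + 6 := by ring
  rw [this]
  linarith

lemma gc_tau_mono : MonotoneOn (fun a : ℝ => a * (Real.log (a + 1) - Real.log a) - 1
      - 1 / 2 * Real.log (5 * a + 1) + 1 / 2 * Real.log (5 * a + 6)) (Ioi 0) := by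
  have hder : ∀ x : ℝ, 0 < x → HasDerivAt
      (fun a : ℝ => a * (Real.log (a + 1) - Real.log a) - 1
      - 1 / 2 * Real.log (5 * a + 1) + 1 / 2 * Real.log (5 * a + 6))
      (1 * (Real.log (x + 1) - Real.log x) + x * (1 / (x + 1) - x⁻¹)
        - 1 / 2 * ((5 * 1) / (5 * x + 1)) + 1 / 2 * ((5 * 1) / (5 * x + 6))) x := by
    intro x hx
    have hx1 : x + 1 ≠ 0 := by positivity
    have hx2 : 5 * x + 1 ≠ 0 := by positivity
    have hx3 : 5 * x + 6 ≠ 0 := by positivity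
    exact (((((hasDerivAt_id x)).mul
      ((((hasDerivAt_id x).add_const 1).log hx1).sub (Real.hasDerivAt_log hx.ne'))).sub_const 1).sub
      (((((hasDerivAt_id x).const_mul 5).add_const 1).log hx2).const_mul (1 / 2))).add
      (((((hasDerivAt_id x).const_mul 5).add_const 6).log hx3).const_mul (1 / 2))
  apply monotoneOn_of_deriv_nonneg (convex_Ioi 0)
  · exact fun x hx => (hder x hx).continuousAt.continuousWithinAt
  · intro x hx
    rw [interior_Ioi] at hx
    exact (hder x hx).differentiableAt.differentiableWithinAt
  · intro x hx
    rw [interior_Ioi] at hx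
    have hx0 : 0 < x := hx
    rw [(hder x hx).deriv]
    refine (gc_F_nonneg x hx0).trans (le_of_eq ?_)
    field_simp
    ring

lemma gcG_mono (p q : ℝ) (hp : 0 < p) (hpq : p ≤ q) : gcG p ≤ gcG q := by
  have hq : 0 < q := by linarith
  apply gc_telescope gcG p q
  · intro m
    have h1 : 0 < p + m := by positivity
    have h2 : 0 < q + m := by positivity
    rw [gcG_step _ h1, gcG_step _ h2]
    exact gc_tau_mono h1 h2 (by linarith)
  · have h3 : ∀ b : ℝ, Filter.Tendsto
        (fun n : ℕ => 1 / 2 * Real.log (1 + 1 / (5 * (b + ((n + 1 : ℕ) : ℝ))))) Filter.atTop (nhds 0) := by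
      intro b
      have hb : Filter.Tendsto (fun n : ℕ => 5 * (b + ((n + 1 : ℕ) : ℝ))) Filter.atTop Filter.atTop :=
        (Filter.tendsto_atTop_add_const_left _ _ (tendsto_natCast_atTop_atTop.comp
          (Filter.tendsto_add_atTop_nat 1))).const_mul_atTop (by norm_num)
      have hb2 : Filter.Tendsto (fun n : ℕ => 1 + 1 / (5 * (b + ((n + 1 : ℕ) : ℝ)))) Filter.atTop
          (nhds (1 + 0)) := (Filter.Tendsto.const_div_atTop hb 1).const_add 1
      rw [add_zero] at hb2
      have h := ((Real.continuousAt_log one_ne_zero).tendsto.comp hb2).const_mul (1 / 2)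
      rw [Real.log_one, mul_zero] at h
      exact h
    have h := ((gcTheta_lim p q hp hq).sub (h3 p)).add (h3 q)
    rw [sub_zero, add_zero] at h
    refine h.congr fun n => ?_
    unfold gcG
    ring

lemma gcTheta_upper (a1 a2 : ℝ) (h1 : 0 < a1) (h12 : a1 < a2) :
    gcTheta a1 - gcTheta a2
      ≤ 1 / 2 * Real.log (1 + (a2 - a1) / (a1 * (1 + 5 * (a1 + (a2 - a1))))) := by
  have h2 : 0 < a2 := by linarith
  have h := gcG_mono a1 a2 h1 h12.le
  unfold gcG at h
  have e : Real.log (1 + (a2 - a1) / (a1 * (1 + 5 * (a1 + (a2 - a1)))))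
      = Real.log (1 + 1 / (5 * a1)) - Real.log (1 + 1 / (5 * a2)) := by
    rw [← Real.log_div (by positivity) (by positivity)]
    congr 1
    have : a1 + (a2 - a1) = a2 := by ring
    rw [this]
    field_simp
    ring
  rw [e]
  linarith

/-- The rate function `t - 1 - log t`. -/
noncomputable def gcH (t : ℝ) : ℝ := t - 1 - Real.log t

/-- Its signed square root, used on `t ≥ 1`. -/
noncomputable def gcS (t : ℝ) : ℝ := Real.sqrt (2 * gcH t)

lemma gcH_deriv (t : ℝ) (ht : 0 < t) : HasDerivAt gcH (1 - t⁻¹) t :=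
  ((hasDerivAt_id t).sub_const 1).sub (Real.hasDerivAt_log ht.ne')

lemma gcH_strictMono : StrictMonoOn gcH (Ici 1) := by
  apply strictMonoOn_of_deriv_pos (convex_Ici 1)
  · intro x hx
    have : (1 : ℝ) ≤ x := hx
    exact (gcH_deriv x (by linarith)).continuousAt.continuousWithinAt
  · intro x hx
    rw [interior_Ici] at hx
    have hx' : (1 : ℝ) < x := hx
    rw [(gcH_deriv x (by linarith)).deriv]
    have := inv_lt_one_of_one_lt₀ hx'
    linarith

lemma gcH_one : gcH 1 = 0 := by simp [gcH]

lemma gcH_nonneg (t : ℝ) (ht : 1 ≤ t) : 0 ≤ gcH t := by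
  rw [← gcH_one]
  exact gcH_strictMono.monotoneOn (mem_Ici.2 le_rfl) (mem_Ici.2 ht) ht

lemma gcH_pos (t : ℝ) (ht : 1 < t) : 0 < gcH t := by
  rw [← gcH_one]
  exact gcH_strictMono (mem_Ici.2 le_rfl) (mem_Ici.2 ht.le) ht

lemma gcH_surj (x L : ℝ) (hx : 1 ≤ x) (hL : gcH x < L) : ∃ q, x < q ∧ gcH q = L := by
  have hL0 : 0 < L := lt_of_le_of_lt (gcH_nonneg x hx) hL
  set T := 2 * (L + 1) + x with hT
  have hTL : L ≤ gcH T := by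
    have h := Real.log_le_sub_one_of_pos (show 0 < T / 2 by rw [hT]; linarith)
    rw [Real.log_div (by rw [hT]; linarith) (by norm_num)] at h
    have h2 := Real.log_two_lt_d9
    unfold gcH
    norm_num at h2
    linarith
  have hxT : x ≤ T := by rw [hT]; linarith
  have hc : ContinuousOn gcH (Icc x T) := fun z hz =>
    (gcH_deriv z (by have := hz.1; linarith)).continuousAt.continuousWithinAt
  obtain ⟨q, hq, hqL⟩ := intermediate_value_Icc hxT hc ⟨hL.le, hTL⟩
  refine ⟨q, lt_of_le_of_ne hq.1 ?_, hqL⟩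
  rintro rfl
  linarith

lemma gcS_sq (t : ℝ) (ht : 1 ≤ t) : gcS t ^ 2 = 2 * gcH t :=
  Real.sq_sqrt (by have := gcH_nonneg t ht; linarith)

lemma gcS_pos (t : ℝ) (ht : 1 < t) : 0 < gcS t :=
  Real.sqrt_pos.2 (by have := gcH_pos t ht; linarith)

lemma gcS_nonneg (t : ℝ) : 0 ≤ gcS t := Real.sqrt_nonneg _

lemma gcS_deriv (t : ℝ) (ht : 1 < t) : HasDerivAt gcS ((t - 1) / (t * gcS t)) t := by
  have hp := gcS_pos t ht
  have h : HasDerivAt gcS (2 * (1 - t⁻¹) / (2 * gcS t)) t :=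
    ((gcH_deriv t (by linarith)).const_mul 2).sqrt (by have := gcH_pos t ht; linarith)
  convert h using 1
  have : t ≠ 0 := by linarith
  field_simp

lemma gcS_strictMono : StrictMonoOn gcS (Ici 1) := by
  intro a ha b hb hab
  apply Real.sqrt_lt_sqrt
  · have := gcH_nonneg a ha; linarith
  · have := gcH_strictMono ha hb hab; linarith

/-- The ratio `s(t)/(t-1)`. -/
noncomputable def gcR (t : ℝ) : ℝ := gcS t / (t - 1)

lemma gcR_deriv (t : ℝ) (ht : 1 < t) :
    HasDerivAt gcR (((t - 1) / (t * gcS t) * (t - 1) - gcS t * 1) / (t - 1) ^ 2) t :=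
  (gcS_deriv t ht).div ((hasDerivAt_id t).sub_const 1) (by simp; linarith)

lemma gcR_anti : AntitoneOn gcR (Ioi 1) := by
  apply antitoneOn_of_deriv_nonpos (convex_Ioi 1)
  · exact fun x hx => (gcR_deriv x hx).continuousAt.continuousWithinAt
  · intro x hx
    rw [interior_Ioi] at hx
    exact (gcR_deriv x hx).differentiableAt.differentiableWithinAt
  · intro t hx
    rw [interior_Ioi] at hx
    have ht : (1 : ℝ) < t := hx
    rw [(gcR_deriv t ht).deriv]
    apply div_nonpos_of_nonpos_of_nonneg _ (by positivity)
    have hp := gcS_pos t ht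
    have h2 := gcS_sq t ht.le
    have hl := gc_log_le_half t ht.le
    have ht0 : 0 < t := by linarith
    have e : (t - 1) / (t * gcS t) * (t - 1) - gcS t * 1
        = ((t - 1) ^ 2 / t - gcS t ^ 2) / gcS t := by field_simp
    rw [e, h2]
    apply div_nonpos_of_nonpos_of_nonneg _ hp.le
    have e2 : (t - 1) ^ 2 / t = t - 2 + 1 / t := by field_simp; ring
    rw [e2]
    unfold gcH
    linarith

/-- The weight. -/
noncomputable def gcW (κ t : ℝ) : ℝ := Real.exp (κ * gcS t) * gcR t

lemma gcW_mono (κ x : ℝ) (hx : 1 < x) (hκ : gcR x / 2 ≤ κ) : MonotoneOn (gcW κ) (Ici x) := by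
  have hder : ∀ t : ℝ, 1 < t → HasDerivAt (gcW κ)
      (Real.exp (κ * gcS t) * (κ * ((t - 1) / (t * gcS t))) * gcR t + Real.exp (κ * gcS t)
        * (((t - 1) / (t * gcS t) * (t - 1) - gcS t * 1) / (t - 1) ^ 2)) t := fun t ht =>
    (((gcS_deriv t ht).const_mul κ).exp).mul (gcR_deriv t ht)
  have hx1 : ∀ t ∈ Ici x, 1 < t := fun t ht => lt_of_lt_of_le hx ht
  apply monotoneOn_of_deriv_nonneg (convex_Ici x)
  · exact fun t ht => (hder t (hx1 t ht)).continuousAt.continuousWithinAt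
  · intro t ht
    exact (hder t (hx1 t (interior_subset ht))).differentiableAt.differentiableWithinAt
  · intro t ht
    have htx : x ≤ t := interior_subset ht
    have ht1 : 1 < t := lt_of_lt_of_le hx htx
    rw [(hder t ht1).deriv]
    have hp := gcS_pos t ht1
    have h2 := gcS_sq t ht1.le
    have hl := gc_two_le_log t ht1.le
    have ht0 : 0 < t := by linarith
    have ht10 : 0 < t - 1 := by linarith
    have hr : gcR t / 2 ≤ κ := by
      have := gcR_anti (mem_Ioi.2 hx) (mem_Ioi.2 ht1) htx
      linarith
    have e : Real.exp (κ * gcS t) * (κ * ((t - 1) / (t * gcS t))) * gcR t + Real.exp (κ * gcS t)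
        * (((t - 1) / (t * gcS t) * (t - 1) - gcS t * 1) / (t - 1) ^ 2)
        = Real.exp (κ * gcS t) / (t * gcS t) * (κ * gcS t + 1 - t * gcS t ^ 2 / (t - 1) ^ 2) := by
      unfold gcR
      field_simp
      ring
    rw [e]
    apply mul_nonneg (by positivity)
    have h3 : gcS t ^ 2 / (2 * (t - 1)) ≤ κ * gcS t := by
      have := mul_le_mul_of_nonneg_right hr hp.le
      refine le_trans (le_of_eq ?_) this
      unfold gcR
      field_simp
    have h4 : t * gcS t ^ 2 / (t - 1) ^ 2 - gcS t ^ 2 / (2 * (t - 1)) ≤ 1 := by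
      have e : t * gcS t ^ 2 / (t - 1) ^ 2 - gcS t ^ 2 / (2 * (t - 1))
          = gcS t ^ 2 * (t + 1) / (2 * (t - 1) ^ 2) := by field_simp; ring
      rw [e, h2, div_le_one (by positivity)]
      rw [div_le_iff₀ (by linarith)] at hl
      unfold gcH
      nlinarith
    linarith

/-- Substitution kernel. -/
noncomputable def gcK (κ t : ℝ) : ℝ := (t - 1) / (t * gcS t) * Real.exp (-(κ * gcS t))

lemma gcW_mul_gcK (κ t : ℝ) (ht : 1 < t) : gcW κ t * gcK κ t = 1 / t := by
  have hp := gcS_pos t ht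
  have ht0 : 0 < t := by linarith
  have ht10 : 0 < t - 1 := by linarith
  unfold gcW gcK gcR
  rw [Real.exp_neg]
  have := Real.exp_pos (κ * gcS t)
  field_simp

lemma gc_subst (a κ x ζ : ℝ) (ha : 0 < a) (hx : 1 ≤ x)
    (hζ0 : 0 ≤ ζ) (hζ : ζ * Real.sqrt a = a * gcS x + κ) :
    IntegrableOn (fun t => Real.exp (-(a * gcH t)) * gcK κ t) (Ioi x) ∧
    Real.sqrt a * ∫ t in Ioi x, Real.exp (-(a * gcH t)) * gcK κ t
      = Real.exp (-(a * gcH x) - κ * gcS x) * ∫ v in Ioi (0 : ℝ), Real.exp (-(v ^ 2 / 2) - ζ * v) := by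
  set g : ℝ → ℝ := fun v => Real.exp (-(v ^ 2 / 2) - ζ * v) with hg
  set φ : ℝ → ℝ := fun t => Real.sqrt a * (gcS t - gcS x) with hφ
  have hsa : 0 < Real.sqrt a := Real.sqrt_pos.2 ha
  have hsa2 : Real.sqrt a ^ 2 = a := Real.sq_sqrt ha.le
  have hder : ∀ t ∈ Ioi x, HasDerivWithinAt φ (Real.sqrt a * ((t - 1) / (t * gcS t))) (Ioi x) t :=
    fun t ht => (((gcS_deriv t (lt_of_le_of_lt hx ht)).sub_const _).const_mul _).hasDerivWithinAt
  have hmem : ∀ t ∈ Ioi x, t ∈ Ici (1 : ℝ) := fun t ht => (lt_of_le_of_lt hx ht).le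
  have hinj : InjOn φ (Ioi x) := by
    intro t ht u hu h
    have h1 : gcS t - gcS x = gcS u - gcS x := mul_left_cancel₀ hsa.ne' h
    exact gcS_strictMono.injOn (hmem t ht) (hmem u hu) (by linarith)
  have himg : φ '' Ioi x = Ioi 0 := by
    ext v
    constructor
    · rintro ⟨t, ht, rfl⟩
      have := gcS_strictMono (mem_Ici.2 hx) (hmem t ht) ht
      exact mul_pos hsa (by linarith)
    · intro hv
      have hv0 : 0 < v := hv
      set u := gcS x + v / Real.sqrt a with hu
      have hvs : 0 < v / Real.sqrt a := by positivity
      have hS0 := gcS_nonneg x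
      have hL : gcH x < u ^ 2 / 2 := by
        have h1 := gcS_sq x hx
        have h2 : gcS x ^ 2 < u ^ 2 := pow_lt_pow_left₀ (by linarith) hS0 (by norm_num)
        linarith
      obtain ⟨q, hq, hqL⟩ := gcH_surj x _ hx hL
      refine ⟨q, hq, ?_⟩
      have : gcS q = u := by
        unfold gcS
        rw [hqL, mul_div_cancel₀ _ (by norm_num : (2 : ℝ) ≠ 0)]
        exact Real.sqrt_sq (by linarith)
      simp only [hφ]
      rw [this, hu]
      field_simp
      ring
  have hpt : ∀ t ∈ Ioi x, |Real.sqrt a * ((t - 1) / (t * gcS t))| • g (φ t)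
      = (Real.sqrt a * Real.exp (a * gcH x + κ * gcS x)) * (Real.exp (-(a * gcH t)) * gcK κ t) := by
    intro t ht
    have ht1 : 1 < t := lt_of_le_of_lt hx ht
    have hp := gcS_pos t ht1
    have ht10 : 0 < t - 1 := by linarith
    have ht0 : 0 < t := by linarith
    rw [abs_of_nonneg (by positivity), smul_eq_mul]
    have e : g (φ t) = Real.exp (a * gcH x + κ * gcS x) *
        (Real.exp (-(a * gcH t)) * Real.exp (-(κ * gcS t))) := by
      rw [← Real.exp_add, ← Real.exp_add]
      simp only [hg, hφ]
      congr 1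
      have h1 := gcS_sq x hx
      have h2 := gcS_sq t ht1.le
      have h3 : gcH x = gcS x ^ 2 / 2 := by linarith
      have h4 : gcH t = gcS t ^ 2 / 2 := by linarith
      rw [h3, h4, mul_pow, hsa2]
      linear_combination (-(gcS t - gcS x)) * hζ
    rw [e]
    unfold gcK
    ring
  have hgi : IntegrableOn g (Ioi 0) := by
    have h0 : Integrable (fun v : ℝ => Real.exp (-(1 / 2) * v ^ 2)) :=
      integrable_exp_neg_mul_sq (by norm_num)
    refine Integrable.mono' h0.integrableOn (by fun_prop) ?_
    refine (ae_restrict_iff' measurableSet_Ioi).2 (Filter.Eventually.of_forall fun v hv => ?_)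
    have hv0 : 0 < v := hv
    rw [Real.norm_eq_abs, abs_of_pos (Real.exp_pos _)]
    apply Real.exp_le_exp.2
    have := mul_nonneg hζ0 hv0.le
    linarith
  have hcpos : 0 < Real.sqrt a * Real.exp (a * gcH x + κ * gcS x) := by positivity
  constructor
  · rw [← himg, integrableOn_image_iff_integrableOn_abs_deriv_smul measurableSet_Ioi hder hinj] at hgi
    have h1 := (integrableOn_congr_fun hpt measurableSet_Ioi).1 hgi
    have h2 := h1.const_mul (Real.sqrt a * Real.exp (a * gcH x + κ * gcS x))⁻¹
    refine h2.congr (Filter.Eventually.of_forall fun t => ?_)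
    simp only
    rw [← mul_assoc, inv_mul_cancel₀ hcpos.ne', one_mul]
  · have h1 := integral_image_eq_integral_abs_deriv_smul measurableSet_Ioi hder hinj g
    rw [himg, setIntegral_congr_fun measurableSet_Ioi hpt, integral_const_mul] at h1
    rw [h1]
    have e : Real.exp (-(a * gcH x) - κ * gcS x) * Real.exp (a * gcH x + κ * gcS x) = 1 := by
      rw [← Real.exp_add, ← Real.exp_zero]
      congr 1
      ring
    linear_combination (-(Real.sqrt a * ∫ t in Ioi x, Real.exp (-(a * gcH t)) * gcK κ t)) * e

lemma gc_pdf_eq (a t : ℝ) (ha : 0 < a) (ht : 0 < t) :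
    gammaPDFReal a a t = Real.sqrt a * Real.exp (-gcTheta a) * Real.exp (-(a * gcH t)) * (1 / t) := by
  have hG := Real.Gamma_pos_of_pos ha
  unfold gammaPDFReal
  rw [if_pos ht.le]
  have e1 : Real.sqrt a = Real.exp (1 / 2 * Real.log a) := by
    rw [Real.sqrt_eq_rpow, Real.rpow_def_of_pos ha]; congr 1; ring
  have e2 : Real.Gamma a = Real.exp (Real.log (Real.Gamma a)) := (Real.exp_log hG).symm
  have e3 : 1 / t = Real.exp (-Real.log t) := by rw [Real.exp_neg, Real.exp_log ht, one_div]
  rw [e1, e3, Real.rpow_def_of_pos ha, Real.rpow_def_of_pos ht]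
  nth_rewrite 1 [e2]
  rw [← Real.exp_sub, ← Real.exp_add, ← Real.exp_add, ← Real.exp_add, ← Real.exp_add, ← Real.exp_add]
  congr 1
  unfold gcTheta gcH
  ring

lemma gc_pdf_integrable (a : ℝ) (ha : 0 < a) : Integrable (gammaPDFReal a a) := by
  refine ⟨(measurable_gammaPDFReal a a).aestronglyMeasurable, ?_⟩
  rw [hasFiniteIntegral_iff_ofReal
    (Filter.Eventually.of_forall fun t => gammaPDFReal_nonneg ha ha t)]
  have h := lintegral_gammaPDF_eq_one ha ha
  unfold gammaPDF at h
  rw [h]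
  exact ENNReal.one_lt_top

lemma gc_cdf (a x : ℝ) (ha : 0 < a) :
    (gammaMeasure a a (Iio x)).toReal = 1 - ∫ t in Ioi x, gammaPDFReal a a t := by
  have := isProbabilityMeasure_gammaMeasure ha ha
  have h1 : (gammaMeasure a a).real (Iio x) = 1 - (gammaMeasure a a).real (Ici x) := by
    rw [← probReal_compl_eq_one_sub measurableSet_Ici, compl_Ici]
  change (gammaMeasure a a).real (Iio x) = _
  rw [h1]
  congr 1
  rw [← integral_Ici_eq_integral_Ioi, integral_eq_lintegral_of_nonneg_ae
    (Filter.Eventually.of_forall fun t => gammaPDFReal_nonneg ha ha t)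
    (measurable_gammaPDFReal a a).aestronglyMeasurable]
  unfold gammaMeasure Measure.real
  rw [withDensity_apply _ measurableSet_Ici]
  rfl

lemma gc_sign (A1 A2 a1 a2 : ℝ) (hA1 : 0 < A1) (hA2 : 0 < A2) (h12 : a1 < a2) :
    ∃ L : ℝ, ∀ h : ℝ, (L ≤ h → A2 * Real.exp (-(a2 * h)) ≤ A1 * Real.exp (-(a1 * h))) ∧
      (h ≤ L → A1 * Real.exp (-(a1 * h)) ≤ A2 * Real.exp (-(a2 * h))) := by
  have hd : 0 < a2 - a1 := by linarith
  have e : ∀ A : ℝ, 0 < A → ∀ b : ℝ, A * Real.exp b = Real.exp (Real.log A + b) := by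
    intro A hA b
    rw [Real.exp_add, Real.exp_log hA]
  refine ⟨(Real.log A2 - Real.log A1) / (a2 - a1), fun h => ⟨fun hh => ?_, fun hh => ?_⟩⟩
  · rw [div_le_iff₀ hd] at hh
    rw [e A1 hA1, e A2 hA2]
    apply Real.exp_le_exp.2
    linarith
  · rw [le_div_iff₀ hd] at hh
    rw [e A1 hA1, e A2 hA2]
    apply Real.exp_le_exp.2
    linarith

/-- Data of the substitution for both shapes simultaneously. -/
lemma gc_both (a1 a2 x : ℝ) (h1 : 0 < a1) (h2 : 0 < a2) (hx : 1 ≤ x) :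
    let κ := gcS x * (Real.sqrt a1 * Real.sqrt a2)
    ∃ Y : ℝ, 0 ≤ Y ∧
    IntegrableOn (fun t => Real.exp (-(a1 * gcH t)) * gcK κ t) (Ioi x) ∧
    IntegrableOn (fun t => Real.exp (-(a2 * gcH t)) * gcK κ t) (Ioi x) ∧
    Real.sqrt a1 * ∫ t in Ioi x, Real.exp (-(a1 * gcH t)) * gcK κ t
      = Real.exp (-(a1 * gcH x)) * Y ∧
    Real.sqrt a2 * ∫ t in Ioi x, Real.exp (-(a2 * gcH t)) * gcK κ t
      = Real.exp (-(a2 * gcH x)) * Y := by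
  intro κ
  have hs := gcS_nonneg x
  have q1 : Real.sqrt a1 ^ 2 = a1 := Real.sq_sqrt h1.le
  have q2 : Real.sqrt a2 ^ 2 = a2 := Real.sq_sqrt h2.le
  set ζ := gcS x * (Real.sqrt a1 + Real.sqrt a2) with hζ
  have hζ0 : 0 ≤ ζ := by positivity
  obtain ⟨i1, e1⟩ := gc_subst a1 κ x ζ h1 hx hζ0
    (by simp only [hζ, κ]; linear_combination gcS x * q1)
  obtain ⟨i2, e2⟩ := gc_subst a2 κ x ζ h2 hx hζ0
    (by simp only [hζ, κ]; linear_combination gcS x * q2)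
  refine ⟨Real.exp (-(κ * gcS x)) * ∫ v in Ioi (0 : ℝ), Real.exp (-(v ^ 2 / 2) - ζ * v),
    mul_nonneg (Real.exp_pos _).le (integral_nonneg fun v => (Real.exp_pos _).le), i1, i2, ?_, ?_⟩
  · rw [e1, ← mul_assoc, ← Real.exp_add]; rfl
  · rw [e2, ← mul_assoc, ← Real.exp_add]; rfl

lemma gcK_nonneg (κ t : ℝ) (ht : 1 < t) : 0 ≤ gcK κ t := by
  have hp := gcS_pos t ht
  have ht0 : 0 < t := by linarith
  have ht10 : 0 < t - 1 := by linarith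
  unfold gcK
  positivity

lemma gc_lower (a1 a2 : ℝ) (h1 : 0 < a1) (h12 : a1 < a2) :
    ∫ t in Ioi (1 : ℝ), gammaPDFReal a1 a1 t ≤ ∫ t in Ioi (1 : ℝ), gammaPDFReal a2 a2 t := by
  have h2 : 0 < a2 := h1.trans h12
  have hθ := gcTheta_anti a1 a2 h1 h12.le
  have hsq : Real.sqrt a1 < Real.sqrt a2 := Real.sqrt_lt_sqrt h1.le h12
  have hs1 : 0 < Real.sqrt a1 := Real.sqrt_pos.2 h1
  have hs2 : 0 < Real.sqrt a2 := Real.sqrt_pos.2 h2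
  set A1 := Real.sqrt a1 * Real.exp (-gcTheta a1) with hA1
  set A2 := Real.sqrt a2 * Real.exp (-gcTheta a2) with hA2
  have hE : Real.exp (-gcTheta a1) ≤ Real.exp (-gcTheta a2) := Real.exp_le_exp.2 (by linarith)
  have hA12 : A1 < A2 := mul_lt_mul hsq hE (Real.exp_pos _) hs2.le
  obtain ⟨L, hL⟩ := gc_sign A1 A2 a1 a2 (by positivity) (by positivity) h12
  have hL0 : gcH 1 < L := by
    by_contra hcon
    push Not at hcon
    have := (hL _).1 hcon
    rw [gcH_one] at this
    simp at this
    linarith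
  obtain ⟨q, hq, hqL⟩ := gcH_surj 1 L le_rfl hL0
  obtain ⟨Y, hY, i1, i2, e1, e2⟩ := gc_both a1 a2 1 h1 h2 le_rfl
  have hS1 : gcS 1 = 0 := by simp [gcS, gcH_one]
  rw [hS1, zero_mul] at i1 i2 e1 e2
  rw [gcH_one, mul_zero, neg_zero, Real.exp_zero, one_mul] at e1 e2
  have hW : ∀ t, gcW 0 t = gcR t := fun t => by simp [gcW]
  have j1 := (gc_pdf_integrable a1 h1).integrableOn (s := Ioi (1 : ℝ))
  have j2 := (gc_pdf_integrable a2 h2).integrableOn (s := Ioi (1 : ℝ))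
  rw [← sub_nonpos, ← integral_sub j1 j2]
  have hle : ∫ t in Ioi (1 : ℝ), (gammaPDFReal a1 a1 t - gammaPDFReal a2 a2 t)
      ≤ ∫ t in Ioi (1 : ℝ), (gcR q * A1 * (Real.exp (-(a1 * gcH t)) * gcK 0 t)
        - gcR q * A2 * (Real.exp (-(a2 * gcH t)) * gcK 0 t)) := by
    apply setIntegral_mono_on (j1.sub j2) ((i1.const_mul _).sub (i2.const_mul _)) measurableSet_Ioi
    intro t ht
    have ht1 : (1 : ℝ) < t := ht
    have ht0 : 0 < t := by linarith
    simp only [Pi.sub_apply]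
    rw [gc_pdf_eq a1 t h1 ht0, gc_pdf_eq a2 t h2 ht0, ← gcW_mul_gcK 0 t ht1, hW]
    have hk := gcK_nonneg 0 t ht1
    have key : 0 ≤ (gcR q - gcR t) * (A1 * Real.exp (-(a1 * gcH t)) - A2 * Real.exp (-(a2 * gcH t))) := by
      rcases le_total t q with htq | htq
      · have hr := gcR_anti (mem_Ioi.2 ht1) (mem_Ioi.2 hq) htq
        have hh := gcH_strictMono.monotoneOn (mem_Ici.2 ht1.le) (mem_Ici.2 hq.le) htq
        have := (hL (gcH t)).2 (hqL ▸ hh)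
        exact mul_nonneg_of_nonpos_of_nonpos (by linarith) (by linarith)
      · have hr := gcR_anti (mem_Ioi.2 hq) (mem_Ioi.2 ht1) htq
        have hh := gcH_strictMono.monotoneOn (mem_Ici.2 hq.le) (mem_Ici.2 ht1.le) htq
        have := (hL (gcH t)).1 (hqL ▸ hh)
        exact mul_nonneg (by linarith) (by linarith)
    have := mul_nonneg key hk
    simp only [← hA1, ← hA2]
    linarith
  refine hle.trans ?_
  rw [integral_sub (i1.const_mul _) (i2.const_mul _), integral_const_mul, integral_const_mul]
  have hRq : 0 ≤ gcR q := div_nonneg (gcS_nonneg q) (by linarith)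
  have f1 : gcR q * A1 * (∫ t in Ioi (1 : ℝ), Real.exp (-(a1 * gcH t)) * gcK 0 t)
      = gcR q * Real.exp (-gcTheta a1) * Y := by
    rw [← e1, hA1]; ring
  have f2 : gcR q * A2 * (∫ t in Ioi (1 : ℝ), Real.exp (-(a2 * gcH t)) * gcK 0 t)
      = gcR q * Real.exp (-gcTheta a2) * Y := by
    rw [← e2, hA2]; ring
  rw [f1, f2]
  have := mul_le_mul_of_nonneg_left hE (mul_nonneg hRq hY)
  linarith

lemma gc_upper (a1 a2 y : ℝ) (h1 : 0 < a1) (h12 : a1 < a2)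
    (hy : y = 1 / (2 * Real.sqrt (a1 * (a2 - a1)))) :
    ∫ t in Ioi (1 + y), gammaPDFReal a2 a2 t ≤ ∫ t in Ioi (1 + y), gammaPDFReal a1 a1 t := by
  have h2 : 0 < a2 := h1.trans h12
  have hd : 0 < a2 - a1 := by linarith
  have hsd : 0 < Real.sqrt (a1 * (a2 - a1)) := Real.sqrt_pos.2 (by positivity)
  have hsd2 : Real.sqrt (a1 * (a2 - a1)) ^ 2 = a1 * (a2 - a1) := Real.sq_sqrt (by positivity)
  have hy0 : 0 < y := by rw [hy]; positivity
  have hady : 4 * a1 * (a2 - a1) * y ^ 2 = 1 := by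
    have : 2 * Real.sqrt (a1 * (a2 - a1)) * y = 1 := by rw [hy]; field_simp
    have h4 : (2 * Real.sqrt (a1 * (a2 - a1)) * y) ^ 2 = 1 := by rw [this]; norm_num
    rw [mul_pow, mul_pow, hsd2] at h4
    linarith
  have hθ : gcTheta a1 - gcTheta a2 ≤ (a2 - a1) * gcH (1 + y) := by
    have := gcTheta_upper a1 a2 h1 h12
    have hE := gc_elem a1 (a2 - a1) y h1 hd hy0 hady
    have : gcH (1 + y) = y - Real.log (1 + y) := by unfold gcH; ring
    rw [this]
    linarith
  set x := 1 + y with hx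
  have hx1 : 1 < x := by linarith
  have hs1 : 0 < Real.sqrt a1 := Real.sqrt_pos.2 h1
  have hs2 : 0 < Real.sqrt a2 := Real.sqrt_pos.2 h2
  set A1 := Real.sqrt a1 * Real.exp (-gcTheta a1) with hA1
  set A2 := Real.sqrt a2 * Real.exp (-gcTheta a2) with hA2
  obtain ⟨L, hL⟩ := gc_sign A1 A2 a1 a2 (by positivity) (by positivity) h12
  have j1 := (gc_pdf_integrable a1 h1).integrableOn (s := Ioi x)
  have j2 := (gc_pdf_integrable a2 h2).integrableOn (s := Ioi x)
  by_cases hL0 : L ≤ gcH x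
  · apply setIntegral_mono_on j2 j1 measurableSet_Ioi
    intro t ht
    have htx : x < t := ht
    have ht0 : 0 < t := by linarith
    rw [gc_pdf_eq a1 t h1 ht0, gc_pdf_eq a2 t h2 ht0]
    apply mul_le_mul_of_nonneg_right _ (by positivity)
    apply (hL (gcH t)).1
    exact hL0.trans (gcH_strictMono.monotoneOn (mem_Ici.2 hx1.le)
      (mem_Ici.2 (hx1.trans htx).le) htx.le)
  push Not at hL0
  obtain ⟨q, hq, hqL⟩ := gcH_surj x L hx1.le hL0
  obtain ⟨Y, hY, i1, i2, e1, e2⟩ := gc_both a1 a2 x h1 h2 hx1.le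
  set κ := gcS x * (Real.sqrt a1 * Real.sqrt a2) with hκ
  have hκR : gcR x / 2 ≤ κ := by
    have e : gcR x / 2 = gcS x * Real.sqrt (a1 * (a2 - a1)) := by
      unfold gcR
      have : x - 1 = 1 / (2 * Real.sqrt (a1 * (a2 - a1))) := by rw [← hy]; linarith
      rw [this]
      field_simp
    rw [e, hκ, ← Real.sqrt_mul h1.le]
    apply mul_le_mul_of_nonneg_left _ (gcS_nonneg x)
    apply Real.sqrt_le_sqrt
    nlinarith
  have hmono := gcW_mono κ x hx1 hκR
  rw [← sub_nonneg, ← integral_sub j1 j2]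
  have hle : ∫ t in Ioi x, (gcW κ q * A1 * (Real.exp (-(a1 * gcH t)) * gcK κ t)
        - gcW κ q * A2 * (Real.exp (-(a2 * gcH t)) * gcK κ t))
      ≤ ∫ t in Ioi x, (gammaPDFReal a1 a1 t - gammaPDFReal a2 a2 t) := by
    apply setIntegral_mono_on ((i1.const_mul _).sub (i2.const_mul _)) (j1.sub j2) measurableSet_Ioi
    intro t ht
    have htx : x < t := ht
    have ht1 : (1 : ℝ) < t := by linarith
    have ht0 : 0 < t := by linarith
    simp only [Pi.sub_apply]
    rw [gc_pdf_eq a1 t h1 ht0, gc_pdf_eq a2 t h2 ht0, ← gcW_mul_gcK κ t ht1]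
    have hk := gcK_nonneg κ t ht1
    have hq1 : 1 < q := by linarith
    have key : 0 ≤ (gcW κ t - gcW κ q) * (A1 * Real.exp (-(a1 * gcH t)) - A2 * Real.exp (-(a2 * gcH t))) := by
      rcases le_total t q with htq | htq
      · have hr := hmono (mem_Ici.2 htx.le) (mem_Ici.2 hq.le) htq
        have hh := gcH_strictMono.monotoneOn (mem_Ici.2 ht1.le) (mem_Ici.2 hq1.le) htq
        have := (hL (gcH t)).2 (hqL ▸ hh)
        exact mul_nonneg_of_nonpos_of_nonpos (by linarith) (by linarith)
      · have hr := hmono (mem_Ici.2 hq.le) (mem_Ici.2 htx.le) htq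
        have hh := gcH_strictMono.monotoneOn (mem_Ici.2 hq1.le) (mem_Ici.2 ht1.le) htq
        have := (hL (gcH t)).1 (hqL ▸ hh)
        exact mul_nonneg (by linarith) (by linarith)
    have := mul_nonneg key hk
    simp only [← hA1, ← hA2]
    linarith
  refine le_trans ?_ hle
  rw [integral_sub (i1.const_mul _) (i2.const_mul _), integral_const_mul, integral_const_mul]
  have hWq : 0 ≤ gcW κ q :=
    mul_nonneg (Real.exp_pos _).le (div_nonneg (gcS_nonneg q) (by linarith))
  have f1 : gcW κ q * A1 * (∫ t in Ioi x, Real.exp (-(a1 * gcH t)) * gcK κ t)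
      = gcW κ q * Y * Real.exp (-gcTheta a1 + -(a1 * gcH x)) := by
    rw [Real.exp_add, hA1]
    linear_combination gcW κ q * Real.exp (-gcTheta a1) * e1
  have f2 : gcW κ q * A2 * (∫ t in Ioi x, Real.exp (-(a2 * gcH t)) * gcK κ t)
      = gcW κ q * Y * Real.exp (-gcTheta a2 + -(a2 * gcH x)) := by
    rw [Real.exp_add, hA2]
    linear_combination gcW κ q * Real.exp (-gcTheta a2) * e2
  rw [f1, f2, ← mul_sub]
  apply mul_nonneg (mul_nonneg hWq hY)
  rw [sub_nonneg]
  apply Real.exp_le_exp.2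
  linarith

/-- For `0 < α₁ < α₂` and `Xᵢ ~ Gamma(αᵢ, αᵢ)`, the unique sign-change point `x₀` of
`Δ(x) = P(X₂ < x) − P(X₁ < x)` satisfies
`1 ≤ x₀ ≤ (2√(α₁(α₂−α₁)) + 1)/(2√(α₁(α₂−α₁)))`. -/
theorem gamma_cdf_crossing_bounds (a1 a2 : ℝ) (h1 : 0 < a1) (h12 : a1 < a2)
    (x0 : ℝ) (hx0 : 0 < x0)
    (hneg : ∀ x : ℝ, 0 < x → x < x0 →
      (gammaMeasure a2 a2 (Iio x)).toReal - (gammaMeasure a1 a1 (Iio x)).toReal < 0)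
    (hpos : ∀ x : ℝ, x0 < x →
      0 < (gammaMeasure a2 a2 (Iio x)).toReal - (gammaMeasure a1 a1 (Iio x)).toReal) :
    1 ≤ x0 ∧
      x0 ≤ (2 * Real.sqrt (a1 * (a2 - a1)) + 1) / (2 * Real.sqrt (a1 * (a2 - a1))) := by
  have h2 : 0 < a2 := h1.trans h12
  have hd : 0 < a2 - a1 := by linarith
  have hsd : 0 < Real.sqrt (a1 * (a2 - a1)) := Real.sqrt_pos.2 (by positivity)
  constructor
  · by_contra hcon
    push Not at hcon
    have h := hpos 1 hcon
    rw [gc_cdf a1 1 h1, gc_cdf a2 1 h2] at h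
    have := gc_lower a1 a2 h1 h12
    linarith
  · have e : (2 * Real.sqrt (a1 * (a2 - a1)) + 1) / (2 * Real.sqrt (a1 * (a2 - a1)))
        = 1 + 1 / (2 * Real.sqrt (a1 * (a2 - a1))) := by
      field_simp
    rw [e]
    by_contra hcon
    push Not at hcon
    have h := hneg _ (by positivity) hcon
    rw [gc_cdf a1 _ h1, gc_cdf a2 _ h2] at h
    have := gc_upper a1 a2 _ h1 h12 rfl
    linarith
end

section
/- For fixed ε ∈ (0,1) and r ≥ 1, the function n ↦ P(Q(nr) ≤ 1+ε), where Q(m) ~ Gamma(m/2, m/2), is strictly increasing over integers n > ε^{−2} r^{−2}. -/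
open MeasureTheory ProbabilityTheory Real Set

lemma aux_nonneg (f f' : ℝ → ℝ) (h0 : f 0 = 0) (hd : ∀ x, 0 ≤ x → HasDerivAt f (f' x) x)
    (hf' : ∀ x, 0 ≤ x → 0 ≤ f' x) {z : ℝ} (hz : 0 ≤ z) : 0 ≤ f z := by
  have hm : MonotoneOn f (Ici 0) := by
    apply monotoneOn_of_deriv_nonneg (convex_Ici 0)
    · exact fun x hx => (hd x hx).continuousAt.continuousWithinAt
    · intro x hx
      rw [interior_Ici] at hx
      exact (hd x (le_of_lt hx)).differentiableAt.differentiableWithinAt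
    · intro x hx
      rw [interior_Ici] at hx
      rw [(hd x (le_of_lt hx)).deriv]
      exact hf' x (le_of_lt hx)
  have := hm (mem_Ici.2 le_rfl) (mem_Ici.2 hz) hz
  linarith

lemma aux_log1p (x : ℝ) (hx : 0 ≤ x) : HasDerivAt (fun z : ℝ => log (1 + z)) (1 / (1 + x)) x := by
  have h : HasDerivAt (fun z : ℝ => 1 + z) 1 x := (hasDerivAt_id x).const_add 1
  exact h.log (by positivity)

lemma log_L1 {z : ℝ} (hz : 0 ≤ z) :
    z / 2 - z ^ 2 / 12 + z / (2 * (1 + z)) + z ^ 2 / (12 * (1 + z) ^ 2) ≤ log (1 + z) := by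
  have := aux_nonneg (fun z => log (1 + z) -
      (z / 2 - z ^ 2 / 12 + z / (2 * (1 + z)) + z ^ 2 / (12 * (1 + z) ^ 2)))
    (fun z => z ^ 4 / (6 * (1 + z) ^ 3)) (by simp) ?_ ?_ hz
  · linarith
  · intro x hx
    have h1 : HasDerivAt (fun z : ℝ => z) 1 x := hasDerivAt_id x
    have hp : HasDerivAt (fun z : ℝ => 1 + z) 1 x := h1.const_add 1
    have hne : (1 + x) ≠ 0 := by positivity
    have := (aux_log1p x hx).sub ((((h1.div_const 2).sub ((h1.pow 2).div_const 12)).add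
      (h1.div (hp.const_mul 2) (by positivity))).add
      ((h1.pow 2).div ((hp.pow 2).const_mul 12)
      (mul_ne_zero (by norm_num) (pow_ne_zero 2 hne))))
    refine this.congr_deriv ?_
    simp only [Pi.pow_apply]
    field_simp
    ring
  · intro x hx; positivity

lemma log_L2 {s : ℝ} (hs : 0 ≤ s) :
    (60 * s + 66 * s ^ 2 + 8 * s ^ 3 - s ^ 4) / (12 * ((1 + s) * (5 + 3 * s))) ≤ log (1 + s) := by
  have := aux_nonneg (fun s => log (1 + s) -
      ((60 * s + 66 * s ^ 2 + 8 * s ^ 3 - s ^ 4) / (12 * ((1 + s) * (5 + 3 * s)))))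
    (fun s => s ^ 5 / (2 * ((1 + s) * (5 + 3 * s)) ^ 2)) (by simp) ?_ ?_ hs
  · linarith
  · intro x hx
    have h1 : HasDerivAt (fun z : ℝ => z) 1 x := hasDerivAt_id x
    have hp : HasDerivAt (fun z : ℝ => 1 + z) 1 x := h1.const_add 1
    have hq : HasDerivAt (fun z : ℝ => 5 + 3 * z) (3 * 1) x := (h1.const_mul 3).const_add 5
    have hne : (1 + x) ≠ 0 := by positivity
    have hne2 : (5 + 3 * x) ≠ 0 := by positivity
    have := (aux_log1p x hx).sub (((((h1.const_mul 60).add ((h1.pow 2).const_mul 66)).add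
      ((h1.pow 3).const_mul 8)).sub (h1.pow 4)).div ((hp.mul hq).const_mul 12)
      (mul_ne_zero (by norm_num) (mul_ne_zero hne hne2)))
    refine this.congr_deriv ?_
    simp only [Pi.pow_apply, Pi.mul_apply, Pi.add_apply, Pi.sub_apply]
    field_simp
    ring
  · intro x hx; positivity

lemma log_L3 {s : ℝ} (hs : 0 ≤ s) : log (1 + s) ≤ s * (6 + s) / (6 + 4 * s) := by
  have := aux_nonneg (fun s => s * (6 + s) / (6 + 4 * s) - log (1 + s))
    (fun s => 4 * s ^ 3 / ((1 + s) * (6 + 4 * s) ^ 2)) (by simp) ?_ ?_ hs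
  · linarith
  · intro x hx
    have h1 : HasDerivAt (fun z : ℝ => z) 1 x := hasDerivAt_id x
    have hp : HasDerivAt (fun z : ℝ => 6 + z) 1 x := h1.const_add 6
    have hq : HasDerivAt (fun z : ℝ => 6 + 4 * z) (4 * 1) x := (h1.const_mul 4).const_add 6
    have hne : (1 + x) ≠ 0 := by positivity
    have hne2 : (6 + 4 * x) ≠ 0 := by positivity
    have := ((h1.mul hp).div hq hne2).sub (aux_log1p x hx)
    refine this.congr_deriv ?_
    simp only [Pi.mul_apply]
    field_simp
    ring
  · intro x hx; positivity

lemma hasDerivAt_lG {x : ℝ} (hx : 0 < x) :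
    HasDerivAt (log ∘ Gamma) (deriv (log ∘ Gamma) x) x := by
  have h1 : DifferentiableAt ℝ Gamma x := differentiableAt_Gamma (fun m => by
    have : (0 : ℝ) ≤ m := Nat.cast_nonneg m
    intro h; linarith)
  exact (h1.log (Gamma_pos_of_pos hx).ne').hasDerivAt

lemma dig_rec {x : ℝ} (hx : 0 < x) :
    deriv (log ∘ Gamma) (x + 1) = deriv (log ∘ Gamma) x + 1 / x := by
  have h1 : HasDerivAt (fun y => (log ∘ Gamma) (y + 1)) (deriv (log ∘ Gamma) (x + 1)) x :=
    (hasDerivAt_lG (by linarith : 0 < x + 1)).comp_add_const x 1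
  have h2 : HasDerivAt (fun y => (log ∘ Gamma) y + log y) (deriv (log ∘ Gamma) x + x⁻¹) x :=
    (hasDerivAt_lG hx).add (hasDerivAt_log hx.ne')
  have h3 : (fun y => (log ∘ Gamma) (y + 1)) =ᶠ[nhds x] (fun y => (log ∘ Gamma) y + log y) := by
    filter_upwards [lt_mem_nhds hx] with y hy
    simp only [Function.comp]
    rw [Gamma_add_one hy.ne', log_mul hy.ne' (Gamma_pos_of_pos hy).ne']
    ring
  rw [one_div]
  exact h1.unique (h2.congr_of_eventuallyEq h3)

lemma dig_lower {x : ℝ} (hx : 0 < x) : log x ≤ deriv (log ∘ Gamma) (x + 1) := by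
  have h := convexOn_log_Gamma.slope_le_of_hasDerivAt (x := x) (y := x + 1) (mem_Ioi.2 hx)
    (mem_Ioi.2 (by linarith)) (by linarith) (hasDerivAt_lG (by linarith))
  rw [slope_def_field] at h
  simp only [Function.comp] at h
  rw [Gamma_add_one hx.ne', log_mul hx.ne' (Gamma_pos_of_pos hx).ne'] at h
  have e : (log x + log (Gamma x) - log (Gamma x)) / (x + 1 - x) = log x := by
    rw [add_sub_cancel_right, add_sub_cancel_left, div_one]
  rw [e] at h
  exact h

/-- The error in the digamma bound. -/
noncomputable def digErr (x : ℝ) : ℝ :=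
  1 / (2 * x) + 1 / (12 * x ^ 2) - (log x - deriv (log ∘ Gamma) x)

lemma digErr_step {x : ℝ} (hx : 0 < x) : digErr (x + 1) ≤ digErr x := by
  unfold digErr
  rw [dig_rec hx]
  have h := log_L1 (z := 1 / x) (by positivity)
  have e : 1 + 1 / x = (x + 1) / x := by field_simp
  rw [e, log_div (by positivity) hx.ne'] at h
  have e2 : 1 / x / 2 - (1 / x) ^ 2 / 12 + 1 / x / (2 * ((x + 1) / x)) +
      (1 / x) ^ 2 / (12 * ((x + 1) / x) ^ 2) =
      1 / x - (1 / (2 * x) + 1 / (12 * x ^ 2)) + (1 / (2 * (x + 1)) + 1 / (12 * (x + 1) ^ 2)) := by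
    field_simp
    ring
  rw [e2] at h
  linarith

lemma digErr_nonneg {x : ℝ} (hx : 0 < x) : 0 ≤ digErr x := by
  have h1 : ∀ n : ℕ, digErr (x + n) ≤ digErr x := by
    intro n
    induction n with
    | zero => simp
    | succ k ih =>
      have := digErr_step (x := x + k) (by positivity)
      push_cast
      rw [← add_assoc]
      linarith
  have h2 : ∀ n : ℕ, -(1 / (x + n)) ≤ digErr x := by
    intro n
    have hy : 0 < x + n := by positivity
    refine le_trans ?_ (h1 (n + 1))
    push_cast
    rw [← add_assoc]
    unfold digErr
    have h3 := dig_lower hy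
    have h4 : log (x + n + 1) - log (x + n) ≤ 1 / (x + n) := by
      rw [← log_div (by positivity) hy.ne']
      refine (log_le_sub_one_of_pos (by positivity)).trans (le_of_eq ?_)
      field_simp
      ring
    have h5 : 0 ≤ 1 / (2 * (x + n + 1)) + 1 / (12 * (x + n + 1) ^ 2) := by positivity
    linarith
  have ht : Filter.Tendsto (fun n : ℕ => -(1 / (x + n))) Filter.atTop (nhds 0) := by
    have : Filter.Tendsto (fun n : ℕ => x + (n : ℝ)) Filter.atTop Filter.atTop :=
      Filter.tendsto_atTop_add_const_left _ _ tendsto_natCast_atTop_atTop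
    have h := this.inv_tendsto_atTop.neg
    rw [neg_zero] at h
    refine h.congr (fun n => by simp)
  exact le_of_tendsto' ht h2

lemma normalizer_bound {a b : ℝ} (ha : 0 < a) (hab : a < b) :
    (b * log b - b - log (Gamma b)) - (a * log a - a - log (Gamma a)) ≤
      (b - a) * (1 / (2 * a) + 1 / (12 * a ^ 2)) := by
  have hd : ∀ x, 0 < x → HasDerivAt (fun x => x * log x - x - (log ∘ Gamma) x)
      (log x - deriv (log ∘ Gamma) x) x := by
    intro x hx
    have := (((hasDerivAt_id' x).mul (hasDerivAt_log hx.ne')).sub (hasDerivAt_id' x)).sub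
      (hasDerivAt_lG hx)
    refine this.congr_deriv ?_
    field_simp
    ring
  obtain ⟨c, hc, he⟩ := exists_hasDerivAt_eq_slope (fun x => x * log x - x - (log ∘ Gamma) x)
    (fun x => log x - deriv (log ∘ Gamma) x) hab
    (fun x hx => (hd x (lt_of_lt_of_le ha hx.1)).continuousAt.continuousWithinAt)
    (fun x hx => hd x (lt_trans ha hx.1))
  have hc0 : 0 < c := lt_trans ha hc.1
  have h1 := digErr_nonneg hc0
  unfold digErr at h1
  have hba : 0 < b - a := sub_pos.2 hab
  rw [eq_div_iff hba.ne'] at he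
  simp only [Function.comp_apply] at he
  rw [← he, mul_comm]
  apply mul_le_mul_of_nonneg_left _ hba.le
  have h2 : 1 / (2 * c) + 1 / (12 * c ^ 2) ≤ 1 / (2 * a) + 1 / (12 * a ^ 2) := by
    have := hc.1.le
    gcongr
  simp only [Function.comp_def] at h1 ⊢
  linarith

/-- The comparison function. -/
noncomputable def cmpV (b t : ℝ) : ℝ :=
  (t - 1 - log t) / (b * (t - 1)) - (t + 9) / (12 * (3 * t + 2)) / b ^ 2 - 1 / (50 * b ^ 3)

/-- Its derivative. -/
noncomputable def cmpV' (b t : ℝ) : ℝ :=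
  (t * log t - t + 1) / (b * t * (t - 1) ^ 2) + 25 / (12 * (3 * t + 2) ^ 2) / b ^ 2

lemma cmpV_hasDerivAt {b t : ℝ} (hb : 0 < b) (ht : 1 < t) :
    HasDerivAt (cmpV b) (cmpV' b t) t := by
  have h1 : HasDerivAt (fun z : ℝ => z) 1 t := hasDerivAt_id t
  have hs : t - 1 ≠ 0 := by linarith
  have ht0 : t ≠ 0 := by linarith
  have hq : HasDerivAt (fun z : ℝ => 3 * z + 2) (3 * 1) t := (h1.const_mul 3).add_const 2
  have hq0 : 3 * t + 2 ≠ 0 := by linarith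
  have := (((((h1.sub_const 1).sub (hasDerivAt_log ht0)).div ((h1.sub_const 1).const_mul b)
    (mul_ne_zero hb.ne' hs)).sub (((h1.add_const 9).div (hq.const_mul 12)
    (mul_ne_zero (by norm_num) hq0)).div_const (b ^ 2))).sub_const (1 / (50 * b ^ 3)))
  refine this.congr_deriv ?_
  unfold cmpV'
  simp only [Pi.sub_apply]
  field_simp
  ring

lemma cmpV_pos {b s : ℝ} (hb : 1 ≤ b) (hs0 : 0 < s) (hs1 : s < 1) (hbs : 1 ≤ 2 * b * s) :
    0 < cmpV b (1 + s) := by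
  unfold cmpV
  have hb0 : 0 < b := by linarith
  have h3 := log_L3 hs0.le
  set u := 1 / b with hu
  have hu0 : 0 < u := by positivity
  have hu1 : u ≤ 1 := by rw [hu, div_le_one hb0]; exact hb
  have hu2 : u ≤ 2 * s := by rw [hu, div_le_iff₀ hb0]; linarith
  have e : (1 + s - 1 - log (1 + s)) / (b * (1 + s - 1)) -
      (1 + s + 9) / (12 * (3 * (1 + s) + 2)) / b ^ 2 - 1 / (50 * b ^ 3) =
      u * ((s - log (1 + s)) / s - (10 + s) / (12 * (5 + 3 * s)) * u - u ^ 2 / 50) := by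
    rw [hu]
    have : 3 * (1 + s) + 2 = 5 + 3 * s := by ring
    rw [this, show 1 + s - 1 = s by ring, show 1 + s + 9 = 10 + s by ring]
    field_simp
  rw [e]
  apply mul_pos hu0
  have h4 : 3 * s / (6 + 4 * s) ≤ (s - log (1 + s)) / s := by
    rw [le_div_iff₀ hs0]
    have : 3 * s / (6 + 4 * s) * s = s - s * (6 + s) / (6 + 4 * s) := by
      field_simp; ring
    linarith
  have h5 : (10 + s) / (12 * (5 + 3 * s)) * u + u ^ 2 / 50 < 3 * s / (6 + 4 * s) := by
    rcases le_total s (1 / 2) with h | h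
    · have : (10 + s) / (12 * (5 + 3 * s)) * u + u ^ 2 / 50 ≤
        (10 + s) / (12 * (5 + 3 * s)) * (2 * s) + (2 * s) ^ 2 / 50 := by gcongr
      refine lt_of_le_of_lt this ?_
      rw [div_mul_eq_mul_div, div_add_div _ _ (by positivity) (by positivity),
        div_lt_div_iff₀ (by positivity) (by positivity)]
      have : 0 < s * s := by positivity
      have : s * s * s ≤ s * s * (1/2) := by gcongr
      have : s * s * s * s ≤ s * s * s * (1/2) := by gcongr
      nlinarith
    · have : (10 + s) / (12 * (5 + 3 * s)) * u + u ^ 2 / 50 ≤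
        (10 + s) / (12 * (5 + 3 * s)) * 1 + 1 ^ 2 / 50 := by gcongr
      refine lt_of_le_of_lt this ?_
      rw [div_mul_eq_mul_div, div_add_div _ _ (by positivity) (by positivity),
        div_lt_div_iff₀ (by positivity) (by positivity)]
      nlinarith
  linarith

lemma cmpV_ineq {a b e s : ℝ} (ha : 1 ≤ a) (hab : a < b) (he0 : 0 < e) (he1 : e < 1)
    (hb : b ≤ a + e / 3000) (hs : e ≤ s) :
    b * s * cmpV b (1 + s) - (1 + s) * cmpV' b (1 + s) ≤
      (s - log (1 + s)) - (1 / (2 * a) + 1 / (12 * a ^ 2)) := by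
  have hs0 : 0 < s := by linarith
  have hb0 : 0 < b := by linarith
  have ha0 : 0 < a := by linarith
  have h2 := log_L2 hs0.le
  unfold cmpV cmpV'
  rw [show 3 * (1 + s) + 2 = 5 + 3 * s by ring, show 1 + s - 1 = s by ring,
    show 1 + s + 9 = 10 + s by ring]
  set L := log (1 + s)
  have hp : 1 / 2 ≤ s * ((10 + s) / (12 * (5 + 3 * s))) + ((1 + s) * L - s) / s ^ 2 := by
    rw [div_le_iff₀ (by positivity)] at h2
    have : s * ((10 + s) / (12 * (5 + 3 * s))) + ((1 + s) * L - s) / s ^ 2 - 1 / 2 =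
      (L * (12 * ((1 + s) * (5 + 3 * s))) - (60 * s + 66 * s ^ 2 + 8 * s ^ 3 - s ^ 4)) /
        (12 * (5 + 3 * s) * s ^ 2) := by
      field_simp
      ring
    have h : 0 ≤ (L * (12 * ((1 + s) * (5 + 3 * s))) - (60 * s + 66 * s ^ 2 + 8 * s ^ 3 - s ^ 4)) /
        (12 * (5 + 3 * s) * s ^ 2) := div_nonneg (by linarith) (by positivity)
    linarith
  have hc : 1 / 12 + 3 * (b - a) ≤ s / 50 + (1 + s) * (25 / (12 * (5 + 3 * s) ^ 2)) := by
    have h1 : 1 / 12 - 3 / 160 * s ≤ (1 + s) * (25 / (12 * (5 + 3 * s) ^ 2)) := by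
      rw [mul_div_assoc', le_div_iff₀ (by positivity)]
      nlinarith [mul_nonneg hs0.le (sq_nonneg (s - 5 / 9)), sq_nonneg (s - 5 / 9)]
    linarith
  have hab2 : 1 / (2 * a) + 1 / (12 * a ^ 2) ≤ 1 / 2 / b + (1 / 12 + 3 * (b - a)) / b ^ 2 := by
    have : 1 / 2 / b + (1 / 12 + 3 * (b - a)) / b ^ 2 - (1 / (2 * a) + 1 / (12 * a ^ 2)) =
      (b - a) * (36 * a ^ 2 - 6 * a * b - (a + b)) / (12 * a ^ 2 * b ^ 2) := by
      field_simp
      ring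
    have h : 0 ≤ (b - a) * (36 * a ^ 2 - 6 * a * b - (a + b)) / (12 * a ^ 2 * b ^ 2) := by
      apply div_nonneg _ (by positivity)
      apply mul_nonneg (by linarith)
      have : b ≤ 2 * a := by linarith
      nlinarith
    linarith
  have key : b * s * ((s - L) / (b * s) - (10 + s) / (12 * (5 + 3 * s)) / b ^ 2 - 1 / (50 * b ^ 3))
      - (1 + s) * (((1 + s) * L - (1 + s) + 1) / (b * (1 + s) * s ^ 2) +
        25 / (12 * (5 + 3 * s) ^ 2) / b ^ 2) =
      (s - L) - (s * ((10 + s) / (12 * (5 + 3 * s))) + ((1 + s) * L - s) / s ^ 2) / b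
       - (s / 50 + (1 + s) * (25 / (12 * (5 + 3 * s) ^ 2))) / b ^ 2 := by
    field_simp
    ring
  rw [key]
  have g1 := div_le_div_of_nonneg_right hp hb0.le
  have g2 := div_le_div_of_nonneg_right hc (by positivity : 0 ≤ b ^ 2)
  linarith

lemma gamma_cdf_hasDerivAt {a y : ℝ} (ha : 0 < a) (hy : 0 < y) :
    HasDerivAt (fun x => cdf (gammaMeasure a a) x) (a ^ a / Gamma a * (y ^ (a - 1) * exp (-(a * y)))) y := by
  have hint : Integrable (gammaPDFReal a a) := by
    refine ⟨(measurable_gammaPDFReal a a).aestronglyMeasurable, ?_⟩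
    rw [hasFiniteIntegral_iff_ofReal (Filter.Eventually.of_forall (gammaPDFReal_nonneg ha ha))]
    have := lintegral_gammaPDF_eq_one ha ha
    unfold gammaPDF at this
    rw [this]
    exact ENNReal.one_lt_top
  have hev : gammaPDFReal a a =ᶠ[nhds y]
      fun x => a ^ a / Gamma a * x ^ (a - 1) * exp (-(a * x)) := by
    filter_upwards [lt_mem_nhds hy] with x hx
    simp [gammaPDFReal, hx.le]
  have hcont : ContinuousAt (gammaPDFReal a a) y := by
    refine ContinuousAt.congr ?_ hev.symm
    refine (continuousAt_const.mul (continuousAt_id.rpow_const (Or.inl hy.ne'))).mul ?_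
    fun_prop
  have h1 := intervalIntegral.integral_hasDerivAt_right (a := 0) (b := y)
    (hint.intervalIntegrable) ((stronglyMeasurable_gammaPDFReal a a).stronglyMeasurableAtFilter) hcont
  have h2 : (fun x => cdf (gammaMeasure a a) x) = fun x =>
      (∫ z in (0 : ℝ)..x, gammaPDFReal a a z) + ∫ z in Iic (0 : ℝ), gammaPDFReal a a z := by
    funext x
    rw [cdf_gammaMeasure_eq_integral ha ha,
      ← intervalIntegral.integral_Iic_sub_Iic hint.integrableOn hint.integrableOn]
    ring
  rw [h2]
  refine (h1.add_const _).congr_deriv ?_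
  rw [hev.eq_of_nhds]
  ring

lemma cmpG_hasDerivAt {b t : ℝ} (hb : 0 < b) (ht : 1 < t) :
    HasDerivAt (fun t => cmpV b t * (t ^ b * exp (-b * t)))
      (t ^ (b - 1) * exp (-(b * t)) * (t * cmpV' b t - b * (t - 1) * cmpV b t)) t := by
  have ht0 : 0 < t := by linarith
  have h1 : HasDerivAt (fun t : ℝ => t ^ b) (b * t ^ (b - 1)) t :=
    hasDerivAt_rpow_const (Or.inl ht0.ne')
  have h2 : HasDerivAt (fun t : ℝ => exp (-b * t)) (exp (-b * t) * (-b * 1)) t :=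
    ((hasDerivAt_id' t).const_mul (-b)).exp
  refine ((cmpV_hasDerivAt hb ht).mul (h1.mul h2)).congr_deriv ?_
  have e : t ^ b = t ^ (b - 1) * t := by
    rw [← rpow_add_one ht0.ne']; congr 1; ring
  simp only [Pi.mul_apply]
  rw [e, show -(b * t) = -b * t by ring]
  ring

lemma cmpG_tendsto {b : ℝ} (hb : 1 ≤ b) :
    Filter.Tendsto (fun t => cmpV b t * (t ^ b * exp (-b * t))) Filter.atTop (nhds 0) := by
  refine bdd_le_mul_tendsto_zero' 3 ?_
    (tendsto_rpow_mul_exp_neg_mul_atTop_nhds_zero b b (by linarith))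
  filter_upwards [Filter.eventually_gt_atTop 1] with t ht
  have hs : 0 < t - 1 := by linarith
  have hb0 : 0 < b := by linarith
  unfold cmpV
  have a1 : 0 ≤ (t - 1 - log t) / (b * (t - 1)) :=
    div_nonneg (by linarith [log_le_sub_one_of_pos (by linarith : 0 < t)]) (by positivity)
  have a2 : (t - 1 - log t) / (b * (t - 1)) ≤ 1 := by
    rw [div_le_one (by positivity)]
    nlinarith [log_pos ht]
  have b1 : 0 ≤ (t + 9) / (12 * (3 * t + 2)) / b ^ 2 := by positivity
  have b2 : (t + 9) / (12 * (3 * t + 2)) / b ^ 2 ≤ 1 := by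
    rw [div_div, div_le_one (by positivity)]
    have : 1 ≤ b ^ 2 := one_le_pow₀ hb
    nlinarith
  have c1 : 0 ≤ 1 / (50 * b ^ 3) := by positivity
  have c2 : 1 / (50 * b ^ 3) ≤ 1 := by
    rw [div_le_one (by positivity)]
    have : 1 ≤ b ^ 3 := one_le_pow₀ hb
    linarith
  rw [abs_le]
  constructor <;> linarith

lemma density_compare {a b t : ℝ} (ha : 0 < a) (hab : a < b) (ht : 0 < t) :
    b ^ b / Gamma b * (t ^ (b - 1) * exp (-(b * t))) *
      ((b - a) * ((t - 1 - log t) - (1 / (2 * a) + 1 / (12 * a ^ 2)))) ≤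
    a ^ a / Gamma a * (t ^ (a - 1) * exp (-(a * t))) -
      b ^ b / Gamma b * (t ^ (b - 1) * exp (-(b * t))) := by
  have form : ∀ c : ℝ, 0 < c → c ^ c / Gamma c * (t ^ (c - 1) * exp (-(c * t))) =
      exp (c * log c - log (Gamma c) + (c - 1) * log t - c * t) := by
    intro c hc
    rw [rpow_def_of_pos hc, rpow_def_of_pos ht]
    nth_rewrite 1 [← exp_log (Gamma_pos_of_pos hc)]
    rw [← exp_sub, ← exp_add, ← exp_add]
    congr 1
    ring
  have hb : 0 < b := ha.trans hab
  rw [form a ha, form b hb]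
  set X := a * log a - log (Gamma a) + (a - 1) * log t - a * t with hX
  set Y := b * log b - log (Gamma b) + (b - 1) * log t - b * t with hY
  have hn := normalizer_bound ha hab
  have h1 : (b - a) * ((t - 1 - log t) - (1 / (2 * a) + 1 / (12 * a ^ 2))) ≤ X - Y := by
    rw [hX, hY]
    linarith
  have h2 := add_one_le_exp (X - Y)
  have h3 : exp X = exp Y * exp (X - Y) := by rw [← exp_add]; congr 1; ring
  rw [h3]
  have h4 := exp_pos Y
  nlinarith

lemma step {e a b : ℝ} (he0 : 0 < e) (he1 : e < 1) (ha : 1 ≤ a) (hae : 1 ≤ 2 * a * e)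
    (hab : a < b) (hb : b ≤ a + e / 3000) :
    cdf (gammaMeasure a a) (1 + e) < cdf (gammaMeasure b b) (1 + e) := by
  have ha0 : 0 < a := by linarith
  have hb0 : 0 < b := by linarith
  have hk : 0 < b ^ b / Gamma b := div_pos (rpow_pos_of_pos hb0 _) (Gamma_pos_of_pos hb0)
  set k := b ^ b / Gamma b with hkd
  set M : ℝ → ℝ := fun t => (cdf (gammaMeasure b b) t - cdf (gammaMeasure a a) t) -
    (b - a) * k * (cmpV b t * (t ^ b * exp (-b * t))) with hM
  have hder : ∀ t, 1 < t → HasDerivAt M ((k * (t ^ (b - 1) * exp (-(b * t))) -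
      a ^ a / Gamma a * (t ^ (a - 1) * exp (-(a * t)))) - (b - a) * k *
      (t ^ (b - 1) * exp (-(b * t)) * (t * cmpV' b t - b * (t - 1) * cmpV b t))) t := by
    intro t ht
    have ht0 : 0 < t := by linarith
    exact ((gamma_cdf_hasDerivAt hb0 ht0).sub (gamma_cdf_hasDerivAt ha0 ht0)).sub
      ((cmpG_hasDerivAt hb0 ht).const_mul _)
  have hanti : AntitoneOn M (Ici (1 + e)) := by
    apply antitoneOn_of_deriv_nonpos (convex_Ici _)
    · intro x hx
      have hx' : 1 + e ≤ x := hx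
      exact (hder x (by linarith)).continuousAt.continuousWithinAt
    · intro x hx
      rw [interior_Ici] at hx
      have hx' : 1 + e < x := hx
      exact (hder x (by linarith)).differentiableAt.differentiableWithinAt
    · intro x hx
      rw [interior_Ici] at hx
      have hx' : 1 + e < x := hx
      rw [(hder x (by linarith)).deriv]
      have h1 := density_compare ha0 hab (by linarith : 0 < x)
      rw [← hkd] at h1
      have h2 := cmpV_ineq (s := x - 1) ha hab he0 he1 hb (by linarith)
      rw [show 1 + (x - 1) = x by ring] at h2
      have hw : 0 ≤ k * (x ^ (b - 1) * exp (-(b * x))) * (b - a) := by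
        have : 0 < x := by linarith
        have : 0 < b - a := by linarith
        positivity
      have h3 := mul_le_mul_of_nonneg_left h2 hw
      linarith
  have hlim : Filter.Tendsto M Filter.atTop (nhds 0) := by
    have := ((tendsto_cdf_atTop (gammaMeasure b b)).sub
      (tendsto_cdf_atTop (gammaMeasure a a))).sub ((cmpG_tendsto (by linarith : 1 ≤ b)).const_mul ((b - a) * k))
    rw [sub_self, mul_zero, sub_zero] at this
    exact this
  have hM0 : 0 ≤ M (1 + e) := by
    apply le_of_tendsto hlim
    filter_upwards [Filter.eventually_ge_atTop (1 + e)] with t ht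
    exact hanti (mem_Ici.2 le_rfl) (mem_Ici.2 ht) ht
  have hV := cmpV_pos (b := b) (s := e) (by linarith) he0 he1 (by nlinarith)
  have hG : 0 < (b - a) * k * (cmpV b (1 + e) * ((1 + e) ^ b * exp (-b * (1 + e)))) := by
    have : 0 < b - a := by linarith
    positivity
  simp only [hM] at hM0
  linarith

lemma chain {e : ℝ} (he0 : 0 < e) (he1 : e < 1) (N : ℕ) : ∀ {a b : ℝ}, 1 ≤ a → 1 ≤ 2 * a * e →
    a < b → b ≤ a + (N + 1) * (e / 3000) →
    cdf (gammaMeasure a a) (1 + e) < cdf (gammaMeasure b b) (1 + e) := by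
  induction N with
  | zero =>
    intro a b ha hae hab hb
    exact step he0 he1 ha hae hab (by simpa using hb)
  | succ k ih =>
    intro a b ha hae hab hb
    push_cast at hb
    by_cases h : b ≤ a + e / 3000
    · exact step he0 he1 ha hae hab h
    · push Not at h
      have h0 : 0 < e / 3000 := by positivity
      refine (step he0 he1 ha hae (b := a + e / 3000) (by linarith) le_rfl).trans
        (ih (by linarith) (by nlinarith) h (by linarith))

/-- For fixed `ε ∈ (0,1)` and `r ≥ 1`, the map `n ↦ P(Q(nr) ≤ 1+ε)`, where
`Q(m) ~ Gamma(m/2, m/2)`, is strictly increasing over integers `n > ε⁻² r⁻²`. -/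
theorem gamma_upper_tail_strictMono (ε : ℝ) (hε : ε ∈ Ioo (0:ℝ) 1) (r : ℕ) (hr : 1 ≤ r) :
    ∀ n m : ℕ, (ε ^ 2 * (r : ℝ) ^ 2)⁻¹ < (n : ℝ) → n < m →
      (gammaMeasure ((n * r : ℕ) / 2 : ℝ) ((n * r : ℕ) / 2 : ℝ) (Iic (1 + ε))).toReal
        < (gammaMeasure ((m * r : ℕ) / 2 : ℝ) ((m * r : ℕ) / 2 : ℝ) (Iic (1 + ε))).toReal := by
  intro n m hn hnm
  obtain ⟨he0, he1⟩ := hε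
  have hr0 : (0 : ℝ) < r := by exact_mod_cast hr
  have hpos : 0 < ε ^ 2 * (r : ℝ) ^ 2 := by positivity
  have hn0 : (0 : ℝ) < n := lt_trans (inv_pos.2 hpos) hn
  have hn1 : (1 : ℝ) ≤ n := by
    have : 0 < n := by exact_mod_cast hn0
    exact_mod_cast this
  have hmain : 1 < n * (ε ^ 2 * (r : ℝ) ^ 2) := by
    rw [inv_lt_iff_one_lt_mul₀ hpos] at hn
    linarith
  have h2 : 2 ≤ n * r := by
    by_contra hcon
    have hn' : 1 ≤ n := by exact_mod_cast hn1
    have hle : n * r ≤ 1 := by omega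
    have e1 : n = 1 := by nlinarith
    have e2 : r = 1 := by nlinarith
    rw [e1, e2] at hmain
    norm_num at hmain
    rw [abs_of_pos he0] at hmain
    linarith
  have h2' : (2 : ℝ) ≤ ((n * r : ℕ) : ℝ) := by exact_mod_cast h2
  have hsq : 1 < (((n * r : ℕ) : ℝ) * ε) ^ 2 := by
    push_cast
    nlinarith
  have hone : 1 < ((n * r : ℕ) : ℝ) * ε := by
    by_contra hcon
    push Not at hcon
    have : 0 ≤ ((n * r : ℕ) : ℝ) * ε := by positivity
    nlinarith
  have hlt : ((n * r : ℕ) : ℝ) < ((m * r : ℕ) : ℝ) := by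
    have : n * r < m * r := Nat.mul_lt_mul_of_pos_right hnm (by omega)
    exact_mod_cast this
  set A : ℝ := ((n * r : ℕ) : ℝ) / 2 with hA
  set B : ℝ := ((m * r : ℕ) : ℝ) / 2 with hB
  have hA1 : 1 ≤ A := by rw [hA]; linarith
  have hAB : A < B := by rw [hA, hB]; linarith
  obtain ⟨N, hN⟩ := exists_nat_ge ((B - A) / (ε / 3000))
  rw [div_le_iff₀ (by positivity)] at hN
  have hc := chain he0 he1 N (a := A) (b := B) hA1 (by rw [hA]; linarith) hAB
    (by nlinarith)
  have : IsProbabilityMeasure (gammaMeasure A A) :=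
    isProbabilityMeasure_gammaMeasure (by linarith) (by linarith)
  have : IsProbabilityMeasure (gammaMeasure B B) :=
    isProbabilityMeasure_gammaMeasure (by linarith) (by linarith)
  rw [cdf_eq_real, cdf_eq_real] at hc
  exact hc
end
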